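/- (One-step feasibility and descent of gradient descent.) Let α > 0, suppose K ∈ 𝕂_α, and let K' = K − η∇C(K) with step size 0 < η ≤ 1/L(α). Then K' ∈ 𝕂_α (in particular K' is mean-square stabilizing) and C(K') ≤ C(K) − (η/2)·‖∇C(K)‖₂². -/

import Mathlib

open Matrix Filter
open scoped Kronecker Topology

namespace MJLS

noncomputable section

attribute [local instance] Classical.propDecidable

/-- Closed-loop matrices `Γ i = A i - B i * K i`. -/
def Gam {d k N : ℕ} (A : Fin N → Matrix (Fin d) (Fin d) ℝ)
    (B : Fin N → Matrix (Fin d) (Fin k) ℝ)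
    (K : Fin N → Matrix (Fin k) (Fin d) ℝ) : Fin N → Matrix (Fin d) (Fin d) ℝ :=
  fun i => A i - B i * K i

/-- The operator `E_i(V) = ∑ j, p i j • V j`. -/
def opE {d N : ℕ} (Pr : Matrix (Fin N) (Fin N) ℝ)
    (V : Fin N → Matrix (Fin d) (Fin d) ℝ) : Fin N → Matrix (Fin d) (Fin d) ℝ :=
  fun i => ∑ j, Pr i j • V j

/-- The matrix `𝒜 = diag(Γᵀ ⊗ Γᵀ) (P ⊗ I)`. -/
def calA {d N : ℕ} (Pr : Matrix (Fin N) (Fin N) ℝ)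
    (Γ : Fin N → Matrix (Fin d) (Fin d) ℝ) :
    Matrix (Fin N × Fin d × Fin d) (Fin N × Fin d × Fin d) ℝ :=
  (Matrix.reindex (Equiv.prodComm (Fin d × Fin d) (Fin N))
      (Equiv.prodComm (Fin d × Fin d) (Fin N))
      (Matrix.blockDiagonal fun i => (Γ i)ᵀ ⊗ₖ (Γ i)ᵀ)) *
    (Pr ⊗ₖ (1 : Matrix (Fin d × Fin d) (Fin d × Fin d) ℝ))

/-- `K` is mean-square stabilizing: the spectral radius of `𝒜` is less than `1`. -/
def MSS {d k N : ℕ} (Pr : Matrix (Fin N) (Fin N) ℝ)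
    (A : Fin N → Matrix (Fin d) (Fin d) ℝ) (B : Fin N → Matrix (Fin d) (Fin k) ℝ)
    (K : Fin N → Matrix (Fin k) (Fin d) ℝ) : Prop :=
  spectralRadius ℂ ((calA Pr (Gam A B K)).map (algebraMap ℝ ℂ)) < 1

/-- `P` solves the coupled Lyapunov equations for the policy `K`. -/
def IsLyap {d k N : ℕ} (Pr : Matrix (Fin N) (Fin N) ℝ)
    (A : Fin N → Matrix (Fin d) (Fin d) ℝ) (B : Fin N → Matrix (Fin d) (Fin k) ℝ)
    (Q : Fin N → Matrix (Fin d) (Fin d) ℝ) (R : Fin N → Matrix (Fin k) (Fin k) ℝ)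
    (K : Fin N → Matrix (Fin k) (Fin d) ℝ)
    (P : Fin N → Matrix (Fin d) (Fin d) ℝ) : Prop :=
  ∀ i, P i = Q i + (K i)ᵀ * R i * K i + (Gam A B K i)ᵀ * opE Pr P i * Gam A B K i

/-- `P^K`, the (for mean-square stabilizing `K`, unique) solution of the coupled
Lyapunov equations. -/
def PK {d k N : ℕ} (Pr : Matrix (Fin N) (Fin N) ℝ)
    (A : Fin N → Matrix (Fin d) (Fin d) ℝ) (B : Fin N → Matrix (Fin d) (Fin k) ℝ)
    (Q : Fin N → Matrix (Fin d) (Fin d) ℝ) (R : Fin N → Matrix (Fin k) (Fin k) ℝ)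
    (K : Fin N → Matrix (Fin k) (Fin d) ℝ) : Fin N → Matrix (Fin d) (Fin d) ℝ :=
  if h : ∃ P, IsLyap Pr A B Q R K P then h.choose else 0

/-- The LQR cost `C(K) = ∑ i, π i * tr(P^K_i Sg)`. -/
def cost {d k N : ℕ} (Pr : Matrix (Fin N) (Fin N) ℝ)
    (A : Fin N → Matrix (Fin d) (Fin d) ℝ) (B : Fin N → Matrix (Fin d) (Fin k) ℝ)
    (Q : Fin N → Matrix (Fin d) (Fin d) ℝ) (R : Fin N → Matrix (Fin k) (Fin k) ℝ)
    (piv : Fin N → ℝ) (Sg : Matrix (Fin d) (Fin d) ℝ)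
    (K : Fin N → Matrix (Fin k) (Fin d) ℝ) : ℝ :=
  ∑ i, piv i * (PK Pr A B Q R K i * Sg).trace

/-- The operator `T_j(V) = ∑ i, p i j • (Γ i * V i * Γ iᵀ)`. -/
def opT {d N : ℕ} (Pr : Matrix (Fin N) (Fin N) ℝ)
    (Γ : Fin N → Matrix (Fin d) (Fin d) ℝ)
    (V : Fin N → Matrix (Fin d) (Fin d) ℝ) : Fin N → Matrix (Fin d) (Fin d) ℝ :=
  fun j => ∑ i, Pr i j • (Γ i * V i * (Γ i)ᵀ)

/-- `𝐗^K = ∑_{t=0}^∞ T^t(X(0))` with `X_i(0) = π i • Sg`. -/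
def XK {d N : ℕ} (Pr : Matrix (Fin N) (Fin N) ℝ) (piv : Fin N → ℝ)
    (Sg : Matrix (Fin d) (Fin d) ℝ) (Γ : Fin N → Matrix (Fin d) (Fin d) ℝ) :
    Fin N → Matrix (Fin d) (Fin d) ℝ :=
  ∑' t : ℕ, (opT Pr Γ)^[t] (fun i => piv i • Sg)

/-- `L^K_i = (R i + B iᵀ E_i(P^K) B i) K i - B iᵀ E_i(P^K) A i`. -/
def LK {d k N : ℕ} (Pr : Matrix (Fin N) (Fin N) ℝ)
    (A : Fin N → Matrix (Fin d) (Fin d) ℝ) (B : Fin N → Matrix (Fin d) (Fin k) ℝ)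
    (Q : Fin N → Matrix (Fin d) (Fin d) ℝ) (R : Fin N → Matrix (Fin k) (Fin k) ℝ)
    (K : Fin N → Matrix (Fin k) (Fin d) ℝ) : Fin N → Matrix (Fin k) (Fin d) ℝ :=
  fun i => (R i + (B i)ᵀ * opE Pr (PK Pr A B Q R K) i * B i) * K i
    - (B i)ᵀ * opE Pr (PK Pr A B Q R K) i * A i

/-- The operator `L_i(V) = Γ iᵀ E_i(V) Γ i`. -/
def opL {d N : ℕ} (Pr : Matrix (Fin N) (Fin N) ℝ)
    (Γ : Fin N → Matrix (Fin d) (Fin d) ℝ)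
    (V : Fin N → Matrix (Fin d) (Fin d) ℝ) : Fin N → Matrix (Fin d) (Fin d) ℝ :=
  fun i => (Γ i)ᵀ * opE Pr V i * Γ i

/-- `(P^K)'[E] = ∑_{t=0}^∞ L^t(Eᵀ L^K + (L^K)ᵀ E)`. -/
def PKd {d k N : ℕ} (Pr : Matrix (Fin N) (Fin N) ℝ)
    (Γ : Fin N → Matrix (Fin d) (Fin d) ℝ)
    (Lk E : Fin N → Matrix (Fin k) (Fin d) ℝ) : Fin N → Matrix (Fin d) (Fin d) ℝ :=
  ∑' t : ℕ, (opL Pr Γ)^[t] (fun i => (E i)ᵀ * Lk i + (Lk i)ᵀ * E i)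

/-- `‖V‖₂² = ∑ i, tr(V iᵀ V i)`. -/
def norm2sq {a b N : ℕ} (V : Fin N → Matrix (Fin a) (Fin b) ℝ) : ℝ :=
  ∑ i, ((V i)ᵀ * V i).trace

/-- The inner product `⟨V, S⟩ = ∑ i, tr(V iᵀ S i)`. -/
def ip {a b N : ℕ} (V S : Fin N → Matrix (Fin a) (Fin b) ℝ) : ℝ :=
  ∑ i, ((V i)ᵀ * S i).trace

/-- The spectral norm (maximal singular value) of a matrix. -/
def specNorm {a b : ℕ} (M : Matrix (Fin a) (Fin b) ℝ) : ℝ :=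
  ⨆ x : {x : EuclideanSpace ℝ (Fin b) // ‖x‖ ≤ 1}, ‖Matrix.toEuclideanLin M x.1‖

/-- The minimal singular value of a square matrix. -/
def sigmaMin {a : ℕ} (M : Matrix (Fin a) (Fin a) ℝ) : ℝ :=
  ⨅ x : {x : EuclideanSpace ℝ (Fin a) // ‖x‖ = 1}, ‖Matrix.toEuclideanLin M x.1‖

/-- `‖V‖_max = max_i ‖V i‖` (spectral norms). -/
def maxNorm {a b N : ℕ} (V : Fin N → Matrix (Fin a) (Fin b) ℝ) : ℝ :=
  ⨆ i, specNorm (V i)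

/-- `Λ_min(V) = min_i σ_min(V i)`. -/
def lamMin {a N : ℕ} (V : Fin N → Matrix (Fin a) (Fin a) ℝ) : ℝ :=
  ⨅ i, sigmaMin (V i)

/-- `μ = (min_i π i) · σ_min(Sg)`. -/
def mu {d N : ℕ} (piv : Fin N → ℝ) (Sg : Matrix (Fin d) (Fin d) ℝ) : ℝ :=
  (⨅ i, piv i) * sigmaMin Sg

/-- `ξ(α) = (1/Λ_min(Q))·((1 + ‖B‖²_max)·α/μ + ‖R‖_max) − 1`. -/
def xi {d k N : ℕ} (B : Fin N → Matrix (Fin d) (Fin k) ℝ)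
    (R : Fin N → Matrix (Fin k) (Fin k) ℝ) (Q : Fin N → Matrix (Fin d) (Fin d) ℝ)
    (piv : Fin N → ℝ) (Sg : Matrix (Fin d) (Fin d) ℝ) (α : ℝ) : ℝ :=
  (1 / lamMin Q) * ((1 + maxNorm B ^ 2) * α / mu piv Sg + maxNorm R) - 1

/-- The smoothness constant
`L(α) = 2·(‖R‖_max + ‖B‖²_max·(1 + 2ξ(α)/‖B‖_max)·α/μ)·α/Λ_min(Q)`. -/
def Lsm {d k N : ℕ} (B : Fin N → Matrix (Fin d) (Fin k) ℝ)
    (R : Fin N → Matrix (Fin k) (Fin k) ℝ) (Q : Fin N → Matrix (Fin d) (Fin d) ℝ)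
    (piv : Fin N → ℝ) (Sg : Matrix (Fin d) (Fin d) ℝ) (α : ℝ) : ℝ :=
  2 * (maxNorm R + maxNorm B ^ 2 * (1 + 2 * xi B R Q piv Sg α / maxNorm B)
      * α / mu piv Sg) * α / lamMin Q

end

/-- vectorization of a tuple -/
def vecT {d N : ℕ} (V : Fin N → Matrix (Fin d) (Fin d) ℝ) : Fin N × Fin d × Fin d → ℝ :=
  fun p => V p.1 p.2.1 p.2.2

/-- inverse of vectorization -/
def unvecT {d N : ℕ} (v : Fin N × Fin d × Fin d → ℝ) : Fin N → Matrix (Fin d) (Fin d) ℝ :=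
  fun i => Matrix.of fun a b => v (i, a, b)

lemma vecT_unvecT {d N : ℕ} (v : Fin N × Fin d × Fin d → ℝ) : vecT (unvecT v) = v := rfl

lemma calA_apply {d N : ℕ} (Pr : Matrix (Fin N) (Fin N) ℝ)
    (Γ : Fin N → Matrix (Fin d) (Fin d) ℝ) (p q : Fin N × Fin d × Fin d) :
    calA Pr Γ p q = Γ p.1 q.2.1 p.2.1 * Γ p.1 q.2.2 p.2.2 * Pr p.1 q.1 := by
  obtain ⟨i, a, b⟩ := p
  obtain ⟨j, c, e⟩ := q
  simp only [calA, Matrix.mul_apply]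
  rw [Finset.sum_eq_single (i, c, e)]
  · simp [Matrix.blockDiagonal_apply, Matrix.kroneckerMap_apply]
  · rintro ⟨i', c', e'⟩ - hne
    simp only [Matrix.reindex_apply, Matrix.submatrix_apply, Matrix.blockDiagonal_apply,
      Matrix.kroneckerMap_apply, Matrix.one_apply]
    by_cases h1 : i = i'
    · by_cases h2 : ((c', e') : Fin d × Fin d) = (c, e)
      · exfalso; apply hne; simp_all
      · simp only [h2, if_false, mul_zero]
    · simp [h1]
  · simp

lemma sum3_comm {α β γ : Type*} [Fintype α] [Fintype β] [Fintype γ] (f : α → β → γ → ℝ) :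
    ∑ j, ∑ c, ∑ e, f j c e = ∑ e, ∑ c, ∑ j, f j c e := by
  rw [Finset.sum_congr rfl fun j _ => Finset.sum_comm (f := f j), Finset.sum_comm]
  exact Finset.sum_congr rfl fun e _ => Finset.sum_comm

lemma calA_mulVec {d N : ℕ} (Pr : Matrix (Fin N) (Fin N) ℝ)
    (Γ : Fin N → Matrix (Fin d) (Fin d) ℝ) (V : Fin N → Matrix (Fin d) (Fin d) ℝ) :
    calA Pr Γ *ᵥ vecT V = vecT (opL Pr Γ V) := by
  ext ⟨i, a, b⟩
  simp only [Matrix.mulVec, dotProduct, calA_apply, vecT, opL, opE, Matrix.mul_apply,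
    Matrix.sum_apply, Matrix.smul_apply, Matrix.transpose_apply, smul_eq_mul,
    Fintype.sum_prod_type, Finset.sum_mul, Finset.mul_sum]
  rw [sum3_comm]
  refine Finset.sum_congr rfl fun x _ => ?_
  rw [Finset.sum_comm]
  refine Finset.sum_congr rfl fun y _ => Finset.sum_congr rfl fun z _ => ?_
  ring

lemma calA_pow_mulVec {d N : ℕ} (Pr : Matrix (Fin N) (Fin N) ℝ)
    (Γ : Fin N → Matrix (Fin d) (Fin d) ℝ) (n : ℕ) (V : Fin N → Matrix (Fin d) (Fin d) ℝ) :
    (calA Pr Γ ^ n) *ᵥ vecT V = vecT ((opL Pr Γ)^[n] V) := by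
  induction n generalizing V with
  | zero => simp
  | succ n ih =>
    rw [pow_succ, ← Matrix.mulVec_mulVec, calA_mulVec, ih, Function.iterate_succ_apply]

/-- Entrywise stability of the operator `opL`. -/
def Stab {d N : ℕ} (Pr : Matrix (Fin N) (Fin N) ℝ)
    (Γ : Fin N → Matrix (Fin d) (Fin d) ℝ) : Prop :=
  ∀ (V : Fin N → Matrix (Fin d) (Fin d) ℝ) i a b,
    Tendsto (fun n : ℕ => (opL Pr Γ)^[n] V i a b) atTop (𝓝 0)

section specrad
attribute [local instance] Matrix.linftyOpNormedRing Matrix.linftyOpNormedAlgebra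

lemma specrad_iff {ι : Type*} [Fintype ι] [DecidableEq ι] (a : Matrix ι ι ℂ) :
    spectralRadius ℂ a < 1 ↔ ∀ p q, Tendsto (fun n : ℕ => (a ^ n) p q) atTop (𝓝 0) := by
  have key : (∀ p q, Tendsto (fun n : ℕ => (a ^ n) p q) atTop (𝓝 0)) ↔
      Tendsto (fun n : ℕ => a ^ n) atTop (𝓝 0) := by
    constructor
    · intro h
      exact tendsto_pi_nhds.2 fun p => tendsto_pi_nhds.2 fun q => h p q
    · intro h p q
      exact tendsto_pi_nhds.1 (tendsto_pi_nhds.1 h p) q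
  rw [key]
  have : CompleteSpace (Matrix ι ι ℂ) := FiniteDimensional.complete ℂ _
  constructor
  · intro h
    obtain ⟨r, hr1, hr2⟩ := ENNReal.lt_iff_exists_nnreal_btwn.1 h
    have hr2' : r < 1 := by exact_mod_cast hr2
    have h1 := (spectrum.pow_nnnorm_pow_one_div_tendsto_nhds_spectralRadius a).eventually_lt_const hr1
    refine tendsto_zero_iff_norm_tendsto_zero.2 ?_
    have hg : Tendsto (fun n : ℕ => (r : ℝ) ^ n) atTop (𝓝 0) :=
      tendsto_pow_atTop_nhds_zero_of_lt_one r.2 (by exact_mod_cast hr2')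
    refine squeeze_zero' (Eventually.of_forall fun n => norm_nonneg _) ?_ hg
    filter_upwards [h1, eventually_gt_atTop 0] with n hn hn0
    have h2 : ((‖a ^ n‖₊ : ENNReal) ^ (1 / n : ℝ)) ^ (n : ℝ) ≤ (r : ENNReal) ^ (n : ℝ) :=
      ENNReal.rpow_le_rpow hn.le (by positivity)
    rw [← ENNReal.rpow_mul, one_div, inv_mul_cancel₀ (by positivity), ENNReal.rpow_one,
      ENNReal.rpow_natCast] at h2
    have h3 : ‖a ^ n‖₊ ≤ r ^ n := by exact_mod_cast h2
    exact_mod_cast h3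
  · intro h
    rcases isEmpty_or_nonempty ι with he | hne
    · simp
    obtain ⟨l, hl, hl2⟩ := spectrum.exists_nnnorm_eq_spectralRadius a
    rw [← hl2]
    by_contra hcon
    have hl1 : 1 ≤ ‖l‖ := by
      have : (1 : ENNReal) ≤ ‖l‖₊ := not_lt.1 hcon
      exact_mod_cast this
    have hn : Tendsto (fun n : ℕ => ‖a ^ n‖) atTop (𝓝 0) := by
      simpa using h.norm
    obtain ⟨n, hn⟩ := (hn.eventually_lt_const zero_lt_one).exists
    have h4 : l ^ n ∈ spectrum ℂ (a ^ n) := spectrum.pow_mem_pow a n hl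
    have h5 := spectrum.norm_le_norm_mul_of_mem h4
    have h6 : ‖(1 : Matrix ι ι ℂ)‖ = 1 := norm_one
    rw [h6, mul_one, norm_pow] at h5
    have := one_le_pow₀ hl1 (n := n)
    linarith

end specrad

lemma mss_iff_stab {d k N : ℕ} (Pr : Matrix (Fin N) (Fin N) ℝ)
    (A : Fin N → Matrix (Fin d) (Fin d) ℝ) (B : Fin N → Matrix (Fin d) (Fin k) ℝ)
    (K : Fin N → Matrix (Fin k) (Fin d) ℝ) :
    MSS Pr A B K ↔ Stab Pr (Gam A B K) := by
  have h0 : MSS Pr A B K ↔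
      spectralRadius ℂ ((calA Pr (Gam A B K)).map (algebraMap ℝ ℂ)) < 1 := by
    unfold MSS
    convert Iff.rfl
  rw [h0, specrad_iff]
  have h1 : ∀ n p q, (((calA Pr (Gam A B K)).map (algebraMap ℝ ℂ)) ^ n) p q =
      (((calA Pr (Gam A B K) ^ n) p q : ℝ) : ℂ) := by
    intro n p q
    have := Matrix.map_pow (calA Pr (Gam A B K)) (algebraMap ℝ ℂ) n
    rw [← this]; rfl
  simp only [h1]
  have h2 : ∀ p q, (Tendsto (fun n : ℕ => (((calA Pr (Gam A B K) ^ n) p q : ℝ) : ℂ)) atTop (𝓝 0)) ↔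
      Tendsto (fun n : ℕ => (calA Pr (Gam A B K) ^ n) p q) atTop (𝓝 0) := by
    intro p q
    exact_mod_cast Filter.tendsto_ofReal_iff (f := fun n : ℕ => (calA Pr (Gam A B K) ^ n) p q)
      (x := 0) (l := atTop)
  simp only [h2]
  constructor
  · intro h V i a b
    have h3 : ∀ n, (opL Pr (Gam A B K))^[n] V i a b =
        ∑ q, (calA Pr (Gam A B K) ^ n) (i, a, b) q * vecT V q := by
      intro n
      exact (congrFun (calA_pow_mulVec Pr (Gam A B K) n V) (i, a, b)).symm
    simp only [h3]
    rw [show (0 : ℝ) = ∑ q : Fin N × Fin d × Fin d, 0 * vecT V q by simp]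
    exact tendsto_finsetSum _ fun q _ => (h _ q).mul_const _
  · intro h p q
    have h3 : ∀ n, (calA Pr (Gam A B K) ^ n) p q =
        (opL Pr (Gam A B K))^[n] (unvecT (Pi.single q 1)) p.1 p.2.1 p.2.2 := by
      intro n
      have := congrFun (calA_pow_mulVec Pr (Gam A B K) n (unvecT (Pi.single q 1))) p
      rw [vecT_unvecT, Matrix.mulVec_single_one] at this
      exact this
    simp only [h3]
    exact h _ _ _ _

lemma stab_det {d N : ℕ} {Pr : Matrix (Fin N) (Fin N) ℝ}
    {Γ : Fin N → Matrix (Fin d) (Fin d) ℝ} (h : Stab Pr Γ) :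
    (1 - calA Pr Γ).det ≠ 0 := by
  intro h0
  obtain ⟨v, hv, hv0⟩ := Matrix.exists_mulVec_eq_zero_iff.2 h0
  apply hv
  rw [Matrix.sub_mulVec, Matrix.one_mulVec, sub_eq_zero] at hv0
  have h1 : opL Pr Γ (unvecT v) = unvecT v := by
    have := calA_mulVec Pr Γ (unvecT v)
    rw [vecT_unvecT, ← hv0] at this
    funext i; ext a b
    exact (congrFun this (i, a, b)).symm
  have h2 : ∀ n, (opL Pr Γ)^[n] (unvecT v) = unvecT v := fun n =>
    Function.iterate_fixed h1 n
  ext ⟨i, a, b⟩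
  have := h (unvecT v) i a b
  simp only [h2] at this
  exact tendsto_nhds_unique tendsto_const_nhds this

lemma solves_iff {d N : ℕ} (Pr : Matrix (Fin N) (Fin N) ℝ)
    (Γ : Fin N → Matrix (Fin d) (Fin d) ℝ) (U S : Fin N → Matrix (Fin d) (Fin d) ℝ) :
    (1 - calA Pr Γ) *ᵥ vecT U = vecT S ↔ ∀ i, U i = S i + opL Pr Γ U i := by
  rw [Matrix.sub_mulVec, Matrix.one_mulVec, calA_mulVec, sub_eq_iff_eq_add]
  constructor
  · intro h i
    ext a b
    exact congrFun h (i, a, b)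
  · intro h
    ext ⟨i, a, b⟩
    exact congrFun (congrFun (h i) a) b

lemma stab_exists {d N : ℕ} {Pr : Matrix (Fin N) (Fin N) ℝ}
    {Γ : Fin N → Matrix (Fin d) (Fin d) ℝ} (h : Stab Pr Γ)
    (S : Fin N → Matrix (Fin d) (Fin d) ℝ) : ∃ U, ∀ i, U i = S i + opL Pr Γ U i := by
  refine ⟨unvecT ((1 - calA Pr Γ)⁻¹ *ᵥ vecT S), ?_⟩
  rw [← solves_iff, vecT_unvecT, Matrix.mulVec_mulVec, Matrix.mul_nonsing_inv, Matrix.one_mulVec]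
  exact isUnit_iff_ne_zero.2 (stab_det h)

lemma PK_spec {d k N : ℕ} {Pr : Matrix (Fin N) (Fin N) ℝ}
    {A : Fin N → Matrix (Fin d) (Fin d) ℝ} {B : Fin N → Matrix (Fin d) (Fin k) ℝ}
    (Q : Fin N → Matrix (Fin d) (Fin d) ℝ) (R : Fin N → Matrix (Fin k) (Fin k) ℝ)
    {K : Fin N → Matrix (Fin k) (Fin d) ℝ} (h : Stab Pr (Gam A B K)) (i : Fin N) :
    PK Pr A B Q R K i = (Q i + (K i)ᵀ * R i * K i) +
      opL Pr (Gam A B K) (PK Pr A B Q R K) i := by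
  have hex : ∃ P, IsLyap Pr A B Q R K P := stab_exists h (fun i => Q i + (K i)ᵀ * R i * K i)
  have : IsLyap Pr A B Q R K (PK Pr A B Q R K) := by
    unfold PK
    rw [dif_pos hex]
    exact hex.choose_spec
  exact this i

/-- bilinear form of a matrix -/
def bf {m n : ℕ} (M : Matrix (Fin m) (Fin n) ℝ) (u : Fin m → ℝ) (v : Fin n → ℝ) : ℝ :=
  u ⬝ᵥ (M *ᵥ v)

/-- squared euclidean length -/
def sq {n : ℕ} (x : Fin n → ℝ) : ℝ := x ⬝ᵥ x

lemma sq_nonneg' {n : ℕ} (x : Fin n → ℝ) : 0 ≤ sq x := by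
  unfold sq dotProduct
  exact Finset.sum_nonneg fun i _ => mul_self_nonneg _

lemma bf_conj {m n a b : ℕ} (X : Matrix (Fin m) (Fin a) ℝ) (M : Matrix (Fin m) (Fin n) ℝ)
    (Y : Matrix (Fin n) (Fin b) ℝ) (u : Fin a → ℝ) (v : Fin b → ℝ) :
    bf (Xᵀ * M * Y) u v = bf M (X *ᵥ u) (Y *ᵥ v) := by
  unfold bf
  rw [← Matrix.mulVec_mulVec, ← Matrix.mulVec_mulVec, Matrix.dotProduct_mulVec,
    Matrix.vecMul_transpose]

lemma bf_opE {d N : ℕ} (Pr : Matrix (Fin N) (Fin N) ℝ)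
    (V : Fin N → Matrix (Fin d) (Fin d) ℝ) (i : Fin N) (u v : Fin d → ℝ) :
    bf (opE Pr V i) u v = ∑ j, Pr i j * bf (V j) u v := by
  unfold bf opE
  simp only [Matrix.sum_mulVec, dotProduct_sum, Matrix.smul_mulVec, dotProduct_smul, smul_eq_mul]

lemma bf_opL {d N : ℕ} (Pr : Matrix (Fin N) (Fin N) ℝ) (Γ : Fin N → Matrix (Fin d) (Fin d) ℝ)
    (V : Fin N → Matrix (Fin d) (Fin d) ℝ) (i : Fin N) (u v : Fin d → ℝ) :
    bf (opL Pr Γ V i) u v = ∑ j, Pr i j * bf (V j) (Γ i *ᵥ u) (Γ i *ᵥ v) := by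
  unfold opL
  rw [bf_conj, bf_opE]

lemma bf_add {m n : ℕ} (M M' : Matrix (Fin m) (Fin n) ℝ) (u : Fin m → ℝ) (v : Fin n → ℝ) :
    bf (M + M') u v = bf M u v + bf M' u v := by
  simp [bf, Matrix.add_mulVec, dotProduct_add]

lemma bf_sub {m n : ℕ} (M M' : Matrix (Fin m) (Fin n) ℝ) (u : Fin m → ℝ) (v : Fin n → ℝ) :
    bf (M - M') u v = bf M u v - bf M' u v := by
  simp [bf, Matrix.sub_mulVec, dotProduct_sub]

lemma bf_neg {m n : ℕ} (M : Matrix (Fin m) (Fin n) ℝ) (u : Fin m → ℝ) (v : Fin n → ℝ) :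
    bf (-M) u v = - bf M u v := by
  simp [bf, Matrix.neg_mulVec, dotProduct_neg]

lemma bf_smul {m n : ℕ} (c : ℝ) (M : Matrix (Fin m) (Fin n) ℝ) (u : Fin m → ℝ) (v : Fin n → ℝ) :
    bf (c • M) u v = c * bf M u v := by
  simp [bf, Matrix.smul_mulVec, dotProduct_smul]

lemma bf_one {n : ℕ} (u : Fin n → ℝ) : bf (1 : Matrix (Fin n) (Fin n) ℝ) u u = sq u := by
  simp [bf, sq]

lemma bf_add_left {m n : ℕ} (M : Matrix (Fin m) (Fin n) ℝ) (u u' : Fin m → ℝ) (v : Fin n → ℝ) :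
    bf M (u + u') v = bf M u v + bf M u' v := by
  simp [bf, add_dotProduct]

lemma bf_smul_left {m n : ℕ} (M : Matrix (Fin m) (Fin n) ℝ) (c : ℝ) (u : Fin m → ℝ)
    (v : Fin n → ℝ) : bf M (c • u) v = c * bf M u v := by
  simp [bf, smul_dotProduct]

lemma bf_add_right {m n : ℕ} (M : Matrix (Fin m) (Fin n) ℝ) (u : Fin m → ℝ) (v v' : Fin n → ℝ) :
    bf M u (v + v') = bf M u v + bf M u v' := by
  simp [bf, Matrix.mulVec_add, dotProduct_add]

lemma bf_smul_right {m n : ℕ} (M : Matrix (Fin m) (Fin n) ℝ) (c : ℝ) (u : Fin m → ℝ)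
    (v : Fin n → ℝ) : bf M u (c • v) = c * bf M u v := by
  simp [bf, Matrix.mulVec_smul, dotProduct_smul]

/-- expansion of the quadratic form -/
lemma qf_expand {n : ℕ} (M : Matrix (Fin n) (Fin n) ℝ) (c : ℝ) (u v : Fin n → ℝ) :
    bf M (u + c • v) (u + c • v) =
      bf M u u + c * (bf M u v + bf M v u) + c ^ 2 * bf M v v := by
  rw [bf_add_left, bf_add_right, bf_add_right, bf_smul_left, bf_smul_left, bf_smul_right,
    bf_smul_right]
  ring

lemma sq_expand {n : ℕ} (c : ℝ) (u v : Fin n → ℝ) :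
    sq (u + c • v) = sq u + 2 * c * (u ⬝ᵥ v) + c ^ 2 * sq v := by
  rw [← bf_one, qf_expand]
  simp only [bf, Matrix.one_mulVec, sq]
  rw [dotProduct_comm v u]; ring

lemma bf_sum_abs {m n : ℕ} (M : Matrix (Fin m) (Fin n) ℝ) (u : Fin m → ℝ) (v : Fin n → ℝ) :
    |bf M u v| ≤ (∑ a, ∑ b, |M a b|) * (sq u + sq v) := by
  have hs : ∀ {n : ℕ} (x : Fin n → ℝ) a, x a ^ 2 ≤ sq x := by
    intro n x a
    unfold sq dotProduct
    rw [pow_two]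
    exact Finset.single_le_sum (f := fun i => x i * x i) (fun i _ => mul_self_nonneg _)
      (Finset.mem_univ a)
  unfold bf
  simp only [dotProduct, Matrix.mulVec, Finset.mul_sum]
  refine (Finset.abs_sum_le_sum_abs _ _).trans ?_
  rw [Finset.sum_mul]
  refine Finset.sum_le_sum fun a _ => ?_
  refine (Finset.abs_sum_le_sum_abs _ _).trans ?_
  rw [Finset.sum_mul]
  refine Finset.sum_le_sum fun b _ => ?_
  rw [show u a * (M a b * v b) = M a b * (u a * v b) by ring, abs_mul]
  refine mul_le_mul_of_nonneg_left ?_ (abs_nonneg _)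
  have h1 := hs u a
  have h2 := hs v b
  rw [abs_le]
  constructor <;> nlinarith [sq_nonneg (u a + v b), sq_nonneg (u a - v b), sq_nonneg (u a),
    sq_nonneg (v b)]

lemma bf_single {m n : ℕ} (M : Matrix (Fin m) (Fin n) ℝ) (a : Fin m) (b : Fin n) :
    bf M (Pi.single a 1) (Pi.single b 1) = M a b := by
  simp [bf]

lemma sq_mulVec_le {m n : ℕ} (M : Matrix (Fin m) (Fin n) ℝ) (x : Fin n → ℝ) :
    sq (M *ᵥ x) ≤ (Mᵀ * M).trace * sq x := by
  have : (Mᵀ * M).trace = ∑ a, ∑ b, M a b ^ 2 := by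
    simp only [Matrix.trace, Matrix.diag, Matrix.mul_apply, Matrix.transpose_apply]
    rw [Finset.sum_comm]
    simp only [pow_two]
  rw [this, Finset.sum_mul]
  unfold sq
  simp only [dotProduct, Matrix.mulVec, ← pow_two]
  exact Finset.sum_le_sum fun a _ => Finset.sum_mul_sq_le_sq_mul_sq _ _ _

lemma opL_mono {d N : ℕ} {Pr : Matrix (Fin N) (Fin N) ℝ} (hPr : ∀ i j, 0 ≤ Pr i j)
    (Γ : Fin N → Matrix (Fin d) (Fin d) ℝ) {V W : Fin N → Matrix (Fin d) (Fin d) ℝ}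
    (h : ∀ i x, bf (V i) x x ≤ bf (W i) x x) (i : Fin N) (x : Fin d → ℝ) :
    bf (opL Pr Γ V i) x x ≤ bf (opL Pr Γ W i) x x := by
  rw [bf_opL, bf_opL]
  exact Finset.sum_le_sum fun j _ => mul_le_mul_of_nonneg_left (h j _) (hPr i j)

/-- comparison principle -/
lemma stab_nonneg {d N : ℕ} {Pr : Matrix (Fin N) (Fin N) ℝ} (hPr : ∀ i j, 0 ≤ Pr i j)
    {Γ : Fin N → Matrix (Fin d) (Fin d) ℝ} (hS : Stab Pr Γ)
    {W : Fin N → Matrix (Fin d) (Fin d) ℝ}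
    (h : ∀ i x, bf (opL Pr Γ W i) x x ≤ bf (W i) x x) (i : Fin N) (x : Fin d → ℝ) :
    0 ≤ bf (W i) x x := by
  have h1 : ∀ n i x, bf ((opL Pr Γ)^[n] W i) x x ≤ bf (W i) x x := by
    intro n
    induction n with
    | zero => intro i x; simp
    | succ n ih =>
      intro i x
      rw [Function.iterate_succ_apply']
      exact (opL_mono hPr Γ ih i x).trans (h i x)
  have h2 : Tendsto (fun n => bf ((opL Pr Γ)^[n] W i) x x) atTop (𝓝 0) := by
    have h3 : ∀ n, bf ((opL Pr Γ)^[n] W i) x x =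
        ∑ a, ∑ b, x a * ((opL Pr Γ)^[n] W i a b * x b) := by
      intro n
      simp only [bf, dotProduct, Matrix.mulVec, Finset.mul_sum]
    simp only [h3]
    have h4 : (0 : ℝ) = ∑ a, ∑ b, x a * (0 * x b) := by simp
    rw [h4]
    exact tendsto_finsetSum _ fun a _ => tendsto_finsetSum _ fun b _ =>
      ((hS W i a b).mul_const _).const_mul _
  exact le_of_tendsto h2 (Eventually.of_forall fun n => h1 n i x)

/-- Lyapunov criterion -/
lemma stab_of_lyap {d N : ℕ} {Pr : Matrix (Fin N) (Fin N) ℝ} (hPr : ∀ i j, 0 ≤ Pr i j)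
    {Γ : Fin N → Matrix (Fin d) (Fin d) ℝ}
    {W : Fin N → Matrix (Fin d) (Fin d) ℝ} (hW : ∀ i x, 0 ≤ bf (W i) x x)
    {c : ℝ} (hc : ∀ i x, bf (W i) x x ≤ c * sq x) {ε : ℝ} (hε : 0 < ε)
    (h : ∀ i x, bf (opL Pr Γ W i) x x + ε * sq x ≤ bf (W i) x x) : Stab Pr Γ := by
  -- enlarge c
  obtain ⟨c', hc'ε, hc'⟩ : ∃ c', ε < c' ∧ ∀ i x, bf (W i) x x ≤ c' * sq x := by
    refine ⟨max c (ε + 1), lt_of_lt_of_le (by linarith) (le_max_right _ _), fun i x => ?_⟩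
    exact (hc i x).trans (mul_le_mul_of_nonneg_right (le_max_left _ _) (sq_nonneg' x))
  have hc0 : 0 < c' := hε.trans hc'ε
  set ρ := 1 - ε / c' with hρ
  have hρ1 : ρ < 1 := by have : 0 < ε / c' := by positivity
                         linarith
  have hρ0 : 0 ≤ ρ := by have : ε / c' ≤ 1 := (div_le_one hc0).2 hc'ε.le
                         linarith
  have hdec : ∀ i x, bf (opL Pr Γ W i) x x ≤ ρ * bf (W i) x x := by
    intro i x
    have h1 := h i x
    have h2 : ε / c' * bf (W i) x x ≤ ε * sq x := by
      have := mul_le_mul_of_nonneg_left (hc' i x) (show 0 ≤ ε / c' by positivity)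
      calc _ ≤ _ := this
        _ = ε * sq x := by field_simp
    rw [hρ]; linarith
  have hlow : ∀ i x, ε * sq x ≤ bf (W i) x x := by
    intro i x
    have h1 := h i x
    have h2 : 0 ≤ bf (opL Pr Γ W i) x x := by
      rw [bf_opL]
      exact Finset.sum_nonneg fun j _ => mul_nonneg (hPr i j) (hW j _)
    linarith
  have step : ∀ (V : Fin N → Matrix (Fin d) (Fin d) ℝ) (D : ℝ), 0 ≤ D →
      (∀ i u v, |bf (V i) u v| ≤ D * (bf (W i) u u + bf (W i) v v)) →
      ∀ i u v, |bf (opL Pr Γ V i) u v| ≤ (D * ρ) * (bf (W i) u u + bf (W i) v v) := by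
    intro V D hD hV i u v
    have h1 : |bf (opL Pr Γ V i) u v| ≤
        D * (bf (opL Pr Γ W i) u u + bf (opL Pr Γ W i) v v) := by
      rw [bf_opL, bf_opL, bf_opL, ← Finset.sum_add_distrib, Finset.mul_sum]
      refine (Finset.abs_sum_le_sum_abs _ _).trans (Finset.sum_le_sum fun j _ => ?_)
      rw [abs_mul, abs_of_nonneg (hPr i j)]
      have := mul_le_mul_of_nonneg_left (hV j (Γ i *ᵥ u) (Γ i *ᵥ v)) (hPr i j)
      linarith
    have h2 := mul_le_mul_of_nonneg_left (add_le_add (hdec i u) (hdec i v)) hD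
    linarith
  intro V i a b
  set C := (∑ j, ∑ a, ∑ b, |V j a b|) / ε with hC
  have hC0 : 0 ≤ C := by
    have : 0 ≤ ∑ j, ∑ a, ∑ b, |V j a b| := Finset.sum_nonneg fun j _ =>
      Finset.sum_nonneg fun a _ => Finset.sum_nonneg fun b _ => abs_nonneg _
    positivity
  have h0 : ∀ i u v, |bf (V i) u v| ≤ C * (bf (W i) u u + bf (W i) v v) := by
    intro i u v
    have h1 := bf_sum_abs (V i) u v
    have h2 : (∑ a, ∑ b, |V i a b|) ≤ ∑ j, ∑ a, ∑ b, |V j a b| :=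
      Finset.single_le_sum (f := fun j => ∑ a, ∑ b, |V j a b|)
        (fun j _ => Finset.sum_nonneg fun a _ => Finset.sum_nonneg fun b _ => abs_nonneg _)
        (Finset.mem_univ i)
    have h3 : 0 ≤ sq u + sq v := add_nonneg (sq_nonneg' u) (sq_nonneg' v)
    have h4 := mul_le_mul_of_nonneg_right h2 h3
    have h5 := mul_le_mul_of_nonneg_left (add_le_add (hlow i u) (hlow i v)) hC0
    have h6 : C * (ε * sq u + ε * sq v) = (∑ j, ∑ a, ∑ b, |V j a b|) * (sq u + sq v) := by
      rw [hC]; field_simp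
    linarith
  have hn : ∀ n, ∀ i u v, |bf ((opL Pr Γ)^[n] V i) u v| ≤
      (C * ρ ^ n) * (bf (W i) u u + bf (W i) v v) := by
    intro n
    induction n with
    | zero => simpa using h0
    | succ n ih =>
      rw [Function.iterate_succ_apply']
      intro i u v
      have := step _ _ (by positivity) ih i u v
      rw [pow_succ]
      linarith
  rw [tendsto_zero_iff_abs_tendsto_zero]
  have hg : Tendsto (fun n : ℕ => (C * ρ ^ n) *
      (bf (W i) (Pi.single a 1) (Pi.single a 1) + bf (W i) (Pi.single b 1) (Pi.single b 1)))
      atTop (𝓝 0) := by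
    have := ((tendsto_pow_atTop_nhds_zero_of_lt_one hρ0 hρ1).const_mul C).mul_const
      (bf (W i) (Pi.single a 1) (Pi.single a 1) + bf (W i) (Pi.single b 1) (Pi.single b 1))
    simpa using this
  refine squeeze_zero (fun n => abs_nonneg _) (fun n => ?_) hg
  have := hn n i (Pi.single a 1) (Pi.single b 1)
  rw [bf_single] at this
  exact this

/-- quantitative perturbation of stability -/
lemma stab_perturb {d N : ℕ} {Pr : Matrix (Fin N) (Fin N) ℝ} (hPr : ∀ i j, 0 ≤ Pr i j)
    (hPrSum : ∀ i, ∑ j, Pr i j = 1)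
    {Γ Γ' : Fin N → Matrix (Fin d) (Fin d) ℝ}
    {W : Fin N → Matrix (Fin d) (Fin d) ℝ} (hW : ∀ i x, 0 ≤ bf (W i) x x)
    {c : ℝ} (hc0 : 0 ≤ c) (hc : ∀ i x, bf (W i) x x ≤ c * sq x) {ε : ℝ} (hε : 0 < ε)
    (h : ∀ i x, bf (opL Pr Γ W i) x x + ε * sq x ≤ bf (W i) x x)
    {κ : ℝ} (hκ : 0 < κ) (hκ2 : c * (2 * κ + κ ^ 2) ≤ ε / 2)
    (hΓ : ∀ i x, sq ((Γ' i - Γ i) *ᵥ x) ≤ κ ^ 2 * sq x) : Stab Pr Γ' := by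
  refine stab_of_lyap hPr hW hc (half_pos hε) fun i x => ?_
  have h1 : ∀ j, κ * bf (W j) (Γ' i *ᵥ x) (Γ' i *ᵥ x) ≤
      κ * ((1 + κ) * bf (W j) (Γ i *ᵥ x) (Γ i *ᵥ x)) + κ * ((1 + κ) * (c * κ * sq x)) := by
    intro j
    set u := Γ i *ᵥ x with hu
    set w := (Γ' i - Γ i) *ᵥ x with hw
    have e1 : Γ' i *ᵥ x = u + (1 : ℝ) • w := by
      rw [hu, hw, one_smul, ← Matrix.add_mulVec]; simp
    have h2 := hW j (w + (-κ) • u)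
    rw [qf_expand] at h2
    rw [e1, qf_expand]
    have h3 := hc j w
    have h4 := mul_le_mul_of_nonneg_left (hΓ i x) hc0
    have h5 := hW j u
    have h6 : bf (W j) w w ≤ c * (κ ^ 2 * sq x) := h3.trans h4
    have h7 : (1 + κ) * bf (W j) w w ≤ (1 + κ) * (c * (κ ^ 2 * sq x)) :=
      mul_le_mul_of_nonneg_left h6 (by linarith)
    nlinarith
  have h2 : ∀ j, bf (W j) (Γ' i *ᵥ x) (Γ' i *ᵥ x) ≤
      (1 + κ) * bf (W j) (Γ i *ᵥ x) (Γ i *ᵥ x) + (1 + κ) * (c * κ * sq x) := by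
    intro j
    have := h1 j
    rw [← mul_add] at this
    exact le_of_mul_le_mul_left this hκ
  have h3 : bf (opL Pr Γ' W i) x x ≤
      (1 + κ) * bf (opL Pr Γ W i) x x + (1 + κ) * (c * κ * sq x) := by
    rw [bf_opL, bf_opL, Finset.mul_sum]
    have e : (1 + κ) * (c * κ * sq x) = ∑ j, Pr i j * ((1 + κ) * (c * κ * sq x)) := by
      rw [← Finset.sum_mul, hPrSum, one_mul]
    rw [e, ← Finset.sum_add_distrib]
    refine Finset.sum_le_sum fun j _ => ?_
    have := mul_le_mul_of_nonneg_left (h2 j) (hPr i j)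
    linarith
  have h4 := h i x
  have h5 := hc i x
  have hs := sq_nonneg' x
  have h6 : κ * bf (opL Pr Γ W i) x x ≤ κ * (c * sq x) := by
    refine mul_le_mul_of_nonneg_left ?_ hκ.le
    have := mul_nonneg hε.le hs
    linarith
  have h7 := mul_le_mul_of_nonneg_right hκ2 hs
  nlinarith

lemma norm_toEuclideanLin_sq {m n : ℕ} (M : Matrix (Fin m) (Fin n) ℝ)
    (x : EuclideanSpace ℝ (Fin n)) :
    ‖Matrix.toEuclideanLin M x‖ ^ 2 = sq (M *ᵥ x.ofLp) := by
  rw [EuclideanSpace.real_norm_sq_eq]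
  simp [sq, dotProduct, pow_two, Matrix.toLpLin_apply]

lemma norm_sq_ofLp {n : ℕ} (x : EuclideanSpace ℝ (Fin n)) : ‖x‖ ^ 2 = sq x.ofLp := by
  rw [EuclideanSpace.real_norm_sq_eq]
  simp [sq, dotProduct, pow_two]

lemma specNorm_bdd {m n : ℕ} (M : Matrix (Fin m) (Fin n) ℝ) :
    BddAbove (Set.range fun x : {x : EuclideanSpace ℝ (Fin n) // ‖x‖ ≤ 1} =>
      ‖Matrix.toEuclideanLin M x.1‖) := by
  refine ⟨‖(Matrix.toEuclideanLin M).toContinuousLinearMap‖, ?_⟩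
  rintro _ ⟨x, rfl⟩
  have := (Matrix.toEuclideanLin M).toContinuousLinearMap.le_opNorm x.1
  refine this.trans ?_
  exact mul_le_of_le_one_right (norm_nonneg _) x.2

lemma specNorm_nonneg {m n : ℕ} (M : Matrix (Fin m) (Fin n) ℝ) : 0 ≤ specNorm M :=
  Real.iSup_nonneg fun _ => norm_nonneg _

lemma norm_le_specNorm {m n : ℕ} (M : Matrix (Fin m) (Fin n) ℝ) (x : EuclideanSpace ℝ (Fin n)) :
    ‖Matrix.toEuclideanLin M x‖ ≤ specNorm M * ‖x‖ := by
  by_cases hx : x = 0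
  · simp [hx]
  have hx' : ‖x‖ ≠ 0 := by simpa using hx
  have h1 : ‖(‖x‖⁻¹ • x)‖ ≤ 1 := by
    rw [norm_smul, norm_inv, norm_norm, inv_mul_cancel₀ hx']
  have h2 := le_ciSup (specNorm_bdd M) ⟨‖x‖⁻¹ • x, h1⟩
  change ‖Matrix.toEuclideanLin M (‖x‖⁻¹ • x)‖ ≤ specNorm M at h2
  rw [map_smul, norm_smul, norm_inv, norm_norm] at h2
  have h3 : 0 < ‖x‖ := norm_pos_iff.2 hx
  rw [inv_mul_le_iff₀ h3] at h2
  linarith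

lemma sq_le_specNorm {m n : ℕ} (M : Matrix (Fin m) (Fin n) ℝ) (x : Fin n → ℝ) :
    sq (M *ᵥ x) ≤ specNorm M ^ 2 * sq x := by
  have h := norm_le_specNorm M (WithLp.toLp 2 x)
  have h2 := pow_le_pow_left₀ (norm_nonneg _) h 2
  rw [norm_toEuclideanLin_sq, mul_pow, norm_sq_ofLp] at h2
  exact h2

lemma dot_sq_le {n : ℕ} (x y : Fin n → ℝ) : (x ⬝ᵥ y) ^ 2 ≤ sq x * sq y := by
  have := Finset.sum_mul_sq_le_sq_mul_sq Finset.univ x y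
  simpa [sq, dotProduct, pow_two] using this

lemma bf_le_specNorm {n : ℕ} (M : Matrix (Fin n) (Fin n) ℝ) (x : Fin n → ℝ) :
    bf M x x ≤ specNorm M * sq x := by
  have h1 := dot_sq_le x (M *ᵥ x)
  have h2 := sq_le_specNorm M x
  have h3 : (bf M x x) ^ 2 ≤ (specNorm M * sq x) ^ 2 := by
    calc _ ≤ _ := h1
      _ ≤ sq x * (specNorm M ^ 2 * sq x) := mul_le_mul_of_nonneg_left h2 (sq_nonneg' x)
      _ = _ := by ring
  exact (abs_le_of_sq_le_sq' h3 (mul_nonneg (specNorm_nonneg M) (sq_nonneg' x))).2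

lemma maxNorm_nonneg {m n N : ℕ} (V : Fin N → Matrix (Fin m) (Fin n) ℝ) : 0 ≤ maxNorm V :=
  Real.iSup_nonneg fun _ => specNorm_nonneg _

lemma specNorm_le_max {m n N : ℕ} (V : Fin N → Matrix (Fin m) (Fin n) ℝ) (i : Fin N) :
    specNorm (V i) ≤ maxNorm V :=
  le_ciSup (f := fun i => specNorm (V i)) (Set.finite_range _).bddAbove i

lemma sq_le_maxNorm {m n N : ℕ} (V : Fin N → Matrix (Fin m) (Fin n) ℝ) (i : Fin N)
    (x : Fin n → ℝ) : sq (V i *ᵥ x) ≤ maxNorm V ^ 2 * sq x :=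
  (sq_le_specNorm (V i) x).trans (mul_le_mul_of_nonneg_right
    (pow_le_pow_left₀ (specNorm_nonneg _) (specNorm_le_max V i) 2) (sq_nonneg' x))

lemma bf_le_maxNorm {n N : ℕ} (V : Fin N → Matrix (Fin n) (Fin n) ℝ) (i : Fin N)
    (x : Fin n → ℝ) : bf (V i) x x ≤ maxNorm V * sq x :=
  (bf_le_specNorm (V i) x).trans (mul_le_mul_of_nonneg_right (specNorm_le_max V i) (sq_nonneg' x))

lemma sigmaMin_nonneg {n : ℕ} (M : Matrix (Fin n) (Fin n) ℝ) : 0 ≤ sigmaMin M :=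
  Real.iInf_nonneg fun _ => norm_nonneg _

lemma sigmaMin_le {n : ℕ} (M : Matrix (Fin n) (Fin n) ℝ) (x : EuclideanSpace ℝ (Fin n))
    (hx : ‖x‖ = 1) : sigmaMin M ≤ ‖Matrix.toEuclideanLin M x‖ :=
  ciInf_le (f := fun x : {x : EuclideanSpace ℝ (Fin n) // ‖x‖ = 1} =>
    ‖Matrix.toEuclideanLin M x.1‖) ⟨0, by rintro _ ⟨x, rfl⟩; exact norm_nonneg _⟩ ⟨x, hx⟩

lemma posDef_bf {n : ℕ} {M : Matrix (Fin n) (Fin n) ℝ} (hM : M.PosDef) {x : Fin n → ℝ}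
    (hx : x ≠ 0) : 0 < bf M x x := by
  have := hM.dotProduct_mulVec_pos hx
  simpa [bf] using this

lemma sigmaMin_pos {n : ℕ} (hn : 0 < n) {M : Matrix (Fin n) (Fin n) ℝ} (hM : M.PosDef) :
    0 < sigmaMin M := by
  have : Nonempty (Fin n) := ⟨⟨0, hn⟩⟩
  have hne : (Metric.sphere (0 : EuclideanSpace ℝ (Fin n)) 1).Nonempty :=
    NormedSpace.sphere_nonempty.2 zero_le_one
  have hcont : Continuous fun x : EuclideanSpace ℝ (Fin n) => ‖Matrix.toEuclideanLin M x‖ :=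
    (LinearMap.continuous_of_finiteDimensional (Matrix.toEuclideanLin M)).norm
  obtain ⟨x0, hx0, hmin⟩ := (isCompact_sphere (0 : EuclideanSpace ℝ (Fin n)) 1).exists_isMinOn hne
    hcont.continuousOn
  have hx01 : ‖x0‖ = 1 := by simpa using hx0
  have hpos : 0 < ‖Matrix.toEuclideanLin M x0‖ := by
    rw [norm_pos_iff]
    intro h0
    have h1 : sq (M *ᵥ x0.ofLp) = 0 := by
      rw [← norm_toEuclideanLin_sq, h0]; simp
    have h2 : x0.ofLp ≠ 0 := by
      intro h
      have : x0 = 0 := by ext a; exact congrFun h a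
      rw [this] at hx01; simp at hx01
    have h3 := posDef_bf hM h2
    have h4 := dot_sq_le x0.ofLp (M *ᵥ x0.ofLp)
    rw [h1, mul_zero] at h4
    change (bf M _ _) ^ 2 ≤ 0 at h4
    nlinarith
  have : Nonempty {x : EuclideanSpace ℝ (Fin n) // ‖x‖ = 1} := ⟨⟨x0, hx01⟩⟩
  refine lt_of_lt_of_le hpos (le_ciInf fun x => ?_)
  exact hmin (by simpa using x.2)

lemma posSemidef_sub_sigma {n : ℕ} {M : Matrix (Fin n) (Fin n) ℝ} (hM : M.PosDef) :
    (M - sigmaMin M • (1 : Matrix (Fin n) (Fin n) ℝ)).PosSemidef := by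
  have hH : (M - sigmaMin M • (1 : Matrix (Fin n) (Fin n) ℝ)).IsHermitian := by
    refine hM.isHermitian.sub ?_
    rw [Matrix.IsHermitian, Matrix.conjTranspose_smul]
    simp
  rw [hH.posSemidef_iff_eigenvalues_nonneg]
  intro j
  have h1 := hH.mulVec_eigenvectorBasis j
  have hv : ‖hH.eigenvectorBasis j‖ = 1 := hH.eigenvectorBasis.orthonormal.1 j
  set v := hH.eigenvectorBasis j with hvdef
  set ν := hH.eigenvalues j with hν
  have h2 : M *ᵥ v.ofLp = (ν + sigmaMin M) • v.ofLp := by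
    rw [Matrix.sub_mulVec, Matrix.smul_mulVec, Matrix.one_mulVec] at h1
    rw [add_smul, ← h1]; simp
  have hv2 : sq v.ofLp = 1 := by rw [← norm_sq_ofLp, hv]; simp
  have h3 : bf M v.ofLp v.ofLp = ν + sigmaMin M := by
    unfold bf
    rw [h2, dotProduct_smul, smul_eq_mul]
    change _ * sq v.ofLp = _
    rw [hv2, mul_one]
  have hv0 : v.ofLp ≠ 0 := by
    intro h; rw [h] at hv2; simp [sq] at hv2
  have h4 : 0 < ν + sigmaMin M := h3 ▸ posDef_bf hM hv0
  have h5 := sigmaMin_le M v hv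
  have h6 : ‖Matrix.toEuclideanLin M v‖ ^ 2 = (ν + sigmaMin M) ^ 2 := by
    rw [norm_toEuclideanLin_sq, h2]
    have : sq ((ν + sigmaMin M) • v.ofLp) = (ν + sigmaMin M) ^ 2 * sq v.ofLp := by
      simp [sq]; ring
    rw [this, hv2, mul_one]
  have h7 : ‖Matrix.toEuclideanLin M v‖ = ν + sigmaMin M := by
    exact (pow_left_inj₀ (norm_nonneg _) h4.le two_ne_zero).1 h6
  change 0 ≤ ν
  linarith

lemma posSemidef_bf {n : ℕ} {M : Matrix (Fin n) (Fin n) ℝ} (hM : M.PosSemidef) (x : Fin n → ℝ) :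
    0 ≤ bf M x x := by
  have := hM.dotProduct_mulVec_nonneg x
  simpa [bf] using this

lemma sigmaMin_bf {n : ℕ} {M : Matrix (Fin n) (Fin n) ℝ} (hM : M.PosDef) (x : Fin n → ℝ) :
    sigmaMin M * sq x ≤ bf M x x := by
  have := posSemidef_bf (posSemidef_sub_sigma hM) x
  rw [bf_sub, bf_smul, bf_one] at this
  linarith

lemma lamMin_le {n N : ℕ} (V : Fin N → Matrix (Fin n) (Fin n) ℝ) (i : Fin N) :
    lamMin V ≤ sigmaMin (V i) :=
  ciInf_le (f := fun i => sigmaMin (V i)) (Set.finite_range _).bddBelow i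

lemma lamMin_pos {n N : ℕ} (hn : 0 < n) (hN : 0 < N) {V : Fin N → Matrix (Fin n) (Fin n) ℝ}
    (hV : ∀ i, (V i).PosDef) : 0 < lamMin V := by
  have : Nonempty (Fin N) := ⟨⟨0, hN⟩⟩
  obtain ⟨i, hi⟩ := exists_eq_ciInf_of_finite (f := fun i => sigmaMin (V i))
  unfold lamMin
  rw [← hi]
  exact sigmaMin_pos hn (hV i)

lemma lamMin_bf {n N : ℕ} {V : Fin N → Matrix (Fin n) (Fin n) ℝ}
    (hV : ∀ i, (V i).PosDef) (i : Fin N) (x : Fin n → ℝ) :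
    lamMin V * sq x ≤ bf (V i) x x :=
  (mul_le_mul_of_nonneg_right (lamMin_le V i) (sq_nonneg' x)).trans (sigmaMin_bf (hV i) x)

lemma mu_pos {d N : ℕ} (hd : 0 < d) (hN : 0 < N) {piv : Fin N → ℝ} (hpiv : ∀ i, 0 < piv i)
    {Sg : Matrix (Fin d) (Fin d) ℝ} (hSg : Sg.PosDef) : 0 < mu piv Sg := by
  have : Nonempty (Fin N) := ⟨⟨0, hN⟩⟩
  obtain ⟨i, hi⟩ := exists_eq_ciInf_of_finite (f := piv)
  unfold mu
  rw [← hi]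
  exact mul_pos (hpiv i) (sigmaMin_pos hd hSg)

lemma mu_le {d N : ℕ} (piv : Fin N → ℝ) (Sg : Matrix (Fin d) (Fin d) ℝ) (i : Fin N) :
    mu piv Sg ≤ piv i * sigmaMin Sg :=
  mul_le_mul_of_nonneg_right (ciInf_le (Set.finite_range _).bddBelow i) (sigmaMin_nonneg Sg)

open scoped MatrixOrder in
lemma trace_nonneg' {n : ℕ} {P M : Matrix (Fin n) (Fin n) ℝ} (hP : ∀ x, 0 ≤ bf P x x)
    (hM : M.PosSemidef) : 0 ≤ (P * M).trace := by
  obtain ⟨H, rfl⟩ := CStarAlgebra.nonneg_iff_eq_star_mul_self.mp hM.nonneg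
  rw [Matrix.star_eq_conjTranspose]
  rw [← Matrix.mul_assoc, Matrix.trace_mul_comm, ← Matrix.mul_assoc]
  refine Finset.sum_nonneg fun a _ => ?_
  have : (H * P * Hᴴ) a a = bf P (H a) (H a) := by
    simp only [Matrix.mul_apply, bf, dotProduct, Matrix.mulVec, Matrix.conjTranspose_apply,
      star_trivial, Finset.sum_mul, Finset.mul_sum]
    rw [Finset.sum_comm]
    refine Finset.sum_congr rfl fun x _ => Finset.sum_congr rfl fun y _ => ?_
    ring
  rw [Matrix.diag_apply, this]
  exact hP _

lemma trace_mono' {n : ℕ} {P P' M : Matrix (Fin n) (Fin n) ℝ}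
    (hP : ∀ x, bf P x x ≤ bf P' x x) (hM : M.PosSemidef) : (P * M).trace ≤ (P' * M).trace := by
  have := trace_nonneg' (P := P' - P) (fun x => by rw [bf_sub]; linarith [hP x]) hM
  rw [Matrix.sub_mul, Matrix.trace_sub] at this
  linarith

lemma bf_le_trace {n : ℕ} {P : Matrix (Fin n) (Fin n) ℝ} (hP : ∀ x, 0 ≤ bf P x x)
    (x : Fin n → ℝ) : bf P x x ≤ P.trace * sq x := by
  have hM : (sq x • (1 : Matrix (Fin n) (Fin n) ℝ) - Matrix.vecMulVec x x).PosSemidef := by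
    refine Matrix.PosSemidef.of_dotProduct_mulVec_nonneg ?_ fun y => ?_
    · ext a b
      simp only [Matrix.conjTranspose_apply, Matrix.sub_apply, Matrix.smul_apply, Matrix.one_apply,
        Matrix.vecMulVec_apply, star_trivial, smul_eq_mul, eq_comm (a := a) (b := b)]
      ring
    · have h1 := dot_sq_le x y
      rw [Matrix.sub_mulVec, Matrix.smul_mulVec, Matrix.one_mulVec, Matrix.vecMulVec_mulVec]
      simp only [star_trivial, dotProduct_sub, dotProduct_smul, smul_eq_mul]
      have h2 : y ⬝ᵥ y = sq y := rfl
      have h3 : y ⬝ᵥ x = x ⬝ᵥ y := dotProduct_comm _ _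
      simp only [MulOpposite.smul_eq_mul_unop, MulOpposite.unop_op, h2, h3]
      nlinarith
  have h := trace_nonneg' hP hM
  rw [Matrix.mul_sub, Matrix.trace_sub, Matrix.mul_smul, Matrix.mul_one, Matrix.trace_smul,
    Matrix.mul_vecMulVec, Matrix.trace_vecMulVec, smul_eq_mul, dotProduct_comm] at h
  change 0 ≤ _ - bf P x x at h
  linarith

lemma bf_le_cost {d N : ℕ} {piv : Fin N → ℝ} (hpiv : ∀ i, 0 < piv i)
    {Sg : Matrix (Fin d) (Fin d) ℝ} (hSg : Sg.PosDef) (hmu : 0 < mu piv Sg)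
    {P : Fin N → Matrix (Fin d) (Fin d) ℝ} (hP : ∀ i x, 0 ≤ bf (P i) x x) {α : ℝ}
    (hα : ∑ i, piv i * (P i * Sg).trace ≤ α) (i : Fin N) (x : Fin d → ℝ) :
    bf (P i) x x ≤ α / mu piv Sg * sq x := by
  have h1 : piv i * (P i * Sg).trace ≤ α := by
    refine le_trans ?_ hα
    exact Finset.single_le_sum (f := fun i => piv i * (P i * Sg).trace)
      (fun j _ => mul_nonneg (hpiv j).le (trace_nonneg' (hP j) hSg.posSemidef)) (Finset.mem_univ i)
  have h2 := trace_nonneg' (hP i) (posSemidef_sub_sigma hSg)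
  rw [Matrix.mul_sub, Matrix.trace_sub, Matrix.mul_smul, Matrix.mul_one, Matrix.trace_smul,
    smul_eq_mul] at h2
  have h3 := bf_le_trace (hP i) x
  have h4 : 0 ≤ (P i).trace := by
    have := trace_nonneg' (hP i) (Matrix.PosSemidef.one (n := Fin d) (R := ℝ))
    simpa using this
  have h5 : mu piv Sg * (P i).trace ≤ α := by
    have a1 := mul_le_mul_of_nonneg_right (mu_le piv Sg i) h4
    have a2 := mul_le_mul_of_nonneg_left h2 (hpiv i).le
    nlinarith
  have h6 : (P i).trace ≤ α / mu piv Sg := by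
    rw [le_div_iff₀ hmu]; linarith
  exact h3.trans (mul_le_mul_of_nonneg_right h6 (sq_nonneg' x))

lemma bf_opL_lin {d N : ℕ} (Pr : Matrix (Fin N) (Fin N) ℝ) (Γ : Fin N → Matrix (Fin d) (Fin d) ℝ)
    (V W : Fin N → Matrix (Fin d) (Fin d) ℝ) (c c' : ℝ) (i : Fin N) (x : Fin d → ℝ) :
    bf (opL Pr Γ (fun i => c • V i + c' • W i) i) x x =
      c * bf (opL Pr Γ V i) x x + c' * bf (opL Pr Γ W i) x x := by
  simp only [bf_opL, bf_add, bf_smul, Finset.mul_sum, ← Finset.sum_add_distrib]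
  refine Finset.sum_congr rfl fun j _ => ?_
  ring

lemma bf_opL_one {d N : ℕ} {Pr : Matrix (Fin N) (Fin N) ℝ} (hPrSum : ∀ i, ∑ j, Pr i j = 1)
    (Γ : Fin N → Matrix (Fin d) (Fin d) ℝ) (i : Fin N) (x : Fin d → ℝ) :
    bf (opL Pr Γ (fun _ => 1) i) x x = sq (Γ i *ᵥ x) := by
  simp only [bf_opL, bf_one]
  rw [← Finset.sum_mul, hPrSum, one_mul]

/-- The static Hessian estimate. -/
lemma hess_bound {d k N : ℕ} {Pr : Matrix (Fin N) (Fin N) ℝ} (hPr : ∀ i j, 0 ≤ Pr i j)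
    (hPrSum : ∀ i, ∑ j, Pr i j = 1)
    {Γ : Fin N → Matrix (Fin d) (Fin d) ℝ} (hS : Stab Pr Γ)
    {B : Fin N → Matrix (Fin d) (Fin k) ℝ}
    {Q : Fin N → Matrix (Fin d) (Fin d) ℝ} {R : Fin N → Matrix (Fin k) (Fin k) ℝ}
    {K E : Fin N → Matrix (Fin k) (Fin d) ℝ}
    {P P1 P2 : Fin N → Matrix (Fin d) (Fin d) ℝ} {a b r Λ e ξ : ℝ}
    (hr0 : 0 ≤ r) (hb0 : 0 ≤ b) (hΛ : 0 < Λ) (he : 0 < e) (haΛ : Λ ≤ a)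
    (hR0 : ∀ i x, 0 ≤ bf (R i) x x) (hR : ∀ i x, bf (R i) x x ≤ r * sq x)
    (hB : ∀ i x, sq (B i *ᵥ x) ≤ b ^ 2 * sq x) (hE : ∀ i x, sq (E i *ᵥ x) ≤ e ^ 2 * sq x)
    (hQ : ∀ i x, Λ * sq x ≤ bf (Q i) x x)
    (hP0 : ∀ i x, 0 ≤ bf (P i) x x) (hPa : ∀ i x, bf (P i) x x ≤ a * sq x)
    (hξ : ξ = (1 / Λ) * ((1 + b ^ 2) * a + r) - 1)
    (eP : ∀ i x, bf (P i) x x = bf (Q i) x x + bf (R i) (K i *ᵥ x) (K i *ᵥ x)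
      + bf (opL Pr Γ P i) x x)
    (eP1 : ∀ i x, bf (P1 i) x x = bf (R i) (E i *ᵥ x) (K i *ᵥ x) + bf (R i) (K i *ᵥ x) (E i *ᵥ x)
      - (bf (opE Pr P i) (B i *ᵥ (E i *ᵥ x)) (Γ i *ᵥ x)
        + bf (opE Pr P i) (Γ i *ᵥ x) (B i *ᵥ (E i *ᵥ x)))
      + bf (opL Pr Γ P1 i) x x)
    (eP2 : ∀ i x, bf (P2 i) x x = 2 * bf (R i) (E i *ᵥ x) (E i *ᵥ x)
      + 2 * bf (opE Pr P i) (B i *ᵥ (E i *ᵥ x)) (B i *ᵥ (E i *ᵥ x))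
      - 2 * (bf (opE Pr P1 i) (B i *ᵥ (E i *ᵥ x)) (Γ i *ᵥ x)
        + bf (opE Pr P1 i) (Γ i *ᵥ x) (B i *ᵥ (E i *ᵥ x)))
      + bf (opL Pr Γ P2 i) x x) (i : Fin N) (x : Fin d → ℝ) :
    bf (P2 i) x x ≤ (2 * (r + b ^ 2 * a + 2 * b * ξ * a) * e ^ 2 / Λ) * bf (P i) x x := by
  have ha0 : 0 ≤ a := hΛ.le.trans haΛ
  have hξ0 : 0 ≤ ξ := by
    have h1 : 1 ≤ (1 / Λ) * ((1 + b ^ 2) * a + r) := by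
      rw [one_div, ← div_eq_inv_mul, le_div_iff₀ hΛ]
      nlinarith [mul_nonneg (sq_nonneg b) ha0]
    linarith
  have hEP0 : ∀ i y, 0 ≤ bf (opE Pr P i) y y := by
    intro i y; rw [bf_opE]
    exact Finset.sum_nonneg fun j _ => mul_nonneg (hPr i j) (hP0 j y)
  have hEbd : ∀ (V : Fin N → Matrix (Fin d) (Fin d) ℝ) (c : ℝ),
      (∀ i x, bf (V i) x x ≤ c * sq x) → ∀ i x, bf (opE Pr V i) x x ≤ c * sq x := by
    intro V c hV i y
    rw [bf_opE]
    calc _ ≤ ∑ j, Pr i j * (c * sq y) :=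
          Finset.sum_le_sum fun j _ => mul_le_mul_of_nonneg_left (hV j y) (hPr i j)
      _ = c * sq y := by rw [← Finset.sum_mul, hPrSum, one_mul]
  have hEPa := hEbd P a hPa
  have hU : ∀ i x, sq (B i *ᵥ (E i *ᵥ x)) ≤ (b * e) ^ 2 * sq x := by
    intro i x
    calc _ ≤ _ := hB i _
      _ ≤ b ^ 2 * (e ^ 2 * sq x) := mul_le_mul_of_nonneg_left (hE i x) (sq_nonneg b)
      _ = _ := by ring
  have hopL : ∀ (V : Fin N → Matrix (Fin d) (Fin d) ℝ) i x,
      bf (opL Pr Γ V i) x x = bf (opE Pr V i) (Γ i *ᵥ x) (Γ i *ᵥ x) := by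
    intro V i x; rw [bf_opL, bf_opE]
  -- bound on the source of `P1`
  have hM1 : ∀ s : ℝ, s ^ 2 = 1 → ∀ i x, s * (bf (R i) (E i *ᵥ x) (K i *ᵥ x) +
      bf (R i) (K i *ᵥ x) (E i *ᵥ x)
      - (bf (opE Pr P i) (B i *ᵥ (E i *ᵥ x)) (Γ i *ᵥ x)
        + bf (opE Pr P i) (Γ i *ᵥ x) (B i *ᵥ (E i *ᵥ x)))) ≤ e * ξ * bf (Q i) x x := by
    intro s hs i x
    have h1 := hR0 i (E i *ᵥ x + (-(s * e)) • (K i *ᵥ x))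
    rw [qf_expand] at h1
    have h2 := hEP0 i (B i *ᵥ (E i *ᵥ x) + (s * e) • (Γ i *ᵥ x))
    rw [qf_expand] at h2
    have h3 := eP i x
    rw [hopL] at h3
    have h4 := hR i (E i *ᵥ x)
    have h5 := mul_le_mul_of_nonneg_left (hE i x) hr0
    have h6 := hEPa i (B i *ᵥ (E i *ᵥ x))
    have h7 := mul_le_mul_of_nonneg_left (hU i x) ha0
    have h8 := hPa i x
    have h9 : ((1 + b ^ 2) * a + r) * sq x ≤ (ξ + 1) * bf (Q i) x x := by
      have : (ξ + 1) = ((1 + b ^ 2) * a + r) / Λ := by rw [hξ]; ring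
      rw [this, div_mul_eq_mul_div, le_div_iff₀ hΛ]
      have hpos : 0 ≤ (1 + b ^ 2) * a + r := by positivity
      nlinarith [mul_le_mul_of_nonneg_left (hQ i x) hpos]
    have hse : (s * e) ^ 2 = e ^ 2 := by rw [mul_pow, hs, one_mul]
    have hse' : (-(s * e)) ^ 2 = e ^ 2 := by rw [neg_sq, hse]
    rw [hse] at h2
    rw [hse'] at h1
    have h10 : bf (R i) (K i *ᵥ x) (K i *ᵥ x) + bf (opE Pr P i) (Γ i *ᵥ x) (Γ i *ᵥ x)
        ≤ a * sq x - bf (Q i) x x := by linarith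
    have h11 := mul_le_mul_of_nonneg_left h10 (sq_nonneg e)
    have h12 := mul_le_mul_of_nonneg_left h9 (sq_nonneg e)
    have h13 : e * (s * (bf (R i) (E i *ᵥ x) (K i *ᵥ x) +
      bf (R i) (K i *ᵥ x) (E i *ᵥ x)
      - (bf (opE Pr P i) (B i *ᵥ (E i *ᵥ x)) (Γ i *ᵥ x)
        + bf (opE Pr P i) (Γ i *ᵥ x) (B i *ᵥ (E i *ᵥ x))))) ≤ e * (e * ξ * bf (Q i) x x) := by
      linarith
    exact le_of_mul_le_mul_left h13 he
  have hP1 : ∀ s : ℝ, s ^ 2 = 1 → ∀ i x, s * bf (P1 i) x x ≤ e * ξ * a * sq x := by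
    intro s hs i x
    have h1 := stab_nonneg hPr hS (W := fun i => (e * ξ) • P i + (-s) • P1 i) (fun i x => by
      rw [bf_opL_lin, bf_add, bf_smul, bf_smul]
      have h2 := hM1 s hs i x
      have h3 := eP i x
      have h4 := eP1 i x
      have h5 := hR0 i (K i *ᵥ x)
      have h6 : 0 ≤ e * ξ * bf (R i) (K i *ᵥ x) (K i *ᵥ x) := by positivity
      rw [h3, h4]
      linarith) i x
    rw [bf_add, bf_smul, bf_smul] at h1
    have h2 := mul_le_mul_of_nonneg_left (hPa i x) (show 0 ≤ e * ξ by positivity)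
    linarith
  set m := e * ξ * a with hm
  have hm0 : 0 ≤ m := by positivity
  have hEP1u := hEbd P1 m (fun i x => by have := hP1 1 (by norm_num) i x; linarith)
  have hEP1l : ∀ i x, - (m * sq x) ≤ bf (opE Pr P1 i) x x := by
    intro i x
    have := hEbd (fun j => (-1 : ℝ) • P1 j) m (fun i x => by
      rw [bf_smul]; exact hP1 (-1) (by norm_num) i x) i x
    rw [bf_opE] at this ⊢
    simp only [bf_smul] at this
    have e1 : ∑ j, Pr i j * (-1 * bf (P1 j) x x) = - ∑ j, Pr i j * bf (P1 j) x x := by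
      rw [← Finset.sum_neg_distrib]
      exact Finset.sum_congr rfl fun j _ => by ring
    rw [e1] at this
    linarith
  have hcross : ∀ i x, -(bf (opE Pr P1 i) (B i *ᵥ (E i *ᵥ x)) (Γ i *ᵥ x)
        + bf (opE Pr P1 i) (Γ i *ᵥ x) (B i *ᵥ (E i *ᵥ x))) ≤
        m * (b * e) * (sq x + sq (Γ i *ᵥ x)) := by
    intro i x
    have hu := hU i x
    set u := B i *ᵥ (E i *ᵥ x) with hudef
    set v := Γ i *ᵥ x with hv
    rcases hb0.eq_or_lt with hb | hb
    · have h0 : sq u = 0 := le_antisymm (by rw [← hb] at hu; simpa using hu) (sq_nonneg' u)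
      have h1 : u = 0 := dotProduct_self_eq_zero.1 h0
      rw [h1, ← hb]
      simp [bf]
    · have hβ : 0 < b * e := mul_pos hb he
      set β := b * e with hβdef
      have h1 := hEP1l i (u + β • v)
      have h2 := hEP1u i (u + (-β) • v)
      rw [qf_expand, sq_expand] at h1 h2
      have h3 := mul_le_mul_of_nonneg_left hu hm0
      refine le_of_mul_le_mul_left ?_ hβ
      nlinarith
  set c1 := 2 * (r + b ^ 2 * a) * e ^ 2 with hc1
  set c2 := 2 * (m * (b * e)) with hc2
  have hc10 : 0 ≤ c1 := by positivity
  have hc20 : 0 ≤ c2 := by positivity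
  have hfin := stab_nonneg hPr hS (W := fun i => (1 : ℝ) • ((c1 / Λ + 2 * c2 / Λ) • P i
      + (-c2) • (1 : Matrix (Fin d) (Fin d) ℝ)) + (-1 : ℝ) • P2 i) (fun i x => by
    rw [bf_opL_lin (V := fun i => (c1 / Λ + 2 * c2 / Λ) • P i
      + (-c2) • (1 : Matrix (Fin d) (Fin d) ℝ)), bf_opL_lin (W := fun _ => 1),
      bf_opL_one hPrSum]
    simp only [bf_add, bf_smul, bf_one]
    have h1 := eP i x
    have h2 := eP2 i x
    have h3 := hcross i x
    have h4 := hR i (E i *ᵥ x)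
    have h5 := mul_le_mul_of_nonneg_left (hE i x) hr0
    have h6 := hEPa i (B i *ᵥ (E i *ᵥ x))
    have h7 := mul_le_mul_of_nonneg_left (hU i x) ha0
    have h8 : (c1 / Λ + 2 * c2 / Λ) * (Λ * sq x) ≤ (c1 / Λ + 2 * c2 / Λ) *
        (bf (Q i) x x + bf (R i) (K i *ᵥ x) (K i *ᵥ x)) := by
      refine mul_le_mul_of_nonneg_left ?_ (by positivity)
      linarith [hQ i x, hR0 i (K i *ᵥ x)]
    have h9 : (c1 / Λ + 2 * c2 / Λ) * (Λ * sq x) = (c1 + 2 * c2) * sq x := by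
      field_simp
    rw [h9] at h8
    rw [h1, h2]
    have h10 : 2 * bf (R i) (E i *ᵥ x) (E i *ᵥ x)
      + 2 * bf (opE Pr P i) (B i *ᵥ (E i *ᵥ x)) (B i *ᵥ (E i *ᵥ x)) ≤ c1 * sq x := by
      rw [hc1]; linarith
    have h11 : -(2 * (bf (opE Pr P1 i) (B i *ᵥ (E i *ᵥ x)) (Γ i *ᵥ x)
        + bf (opE Pr P1 i) (Γ i *ᵥ x) (B i *ᵥ (E i *ᵥ x)))) ≤ c2 * (sq x + sq (Γ i *ᵥ x)) := by
      rw [hc2]; linarith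
    linarith) i x
  simp only [bf_add, bf_smul, bf_one] at hfin
  have h1 : (c1 / Λ + 2 * c2 / Λ) = 2 * (r + b ^ 2 * a + 2 * b * ξ * a) * e ^ 2 / Λ := by
    rw [hc1, hc2, hm]; ring
  rw [h1] at hfin
  have h2 := mul_nonneg hc20 (sq_nonneg' x)
  linarith

lemma diff_det {F ι : Type*} [NormedAddCommGroup F] [NormedSpace ℝ F] [Fintype ι] [DecidableEq ι]
    {M : F → Matrix ι ι ℝ} {x0 : F}
    (hM : ∀ p q, DifferentiableAt ℝ (fun x => M x p q) x0) :
    DifferentiableAt ℝ (fun x => (M x).det) x0 := by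
  simp only [Matrix.det_apply]
  refine DifferentiableAt.fun_sum fun σ _ => ?_
  refine DifferentiableAt.const_smul (c := (Equiv.Perm.sign σ)) ?_
  exact (HasFDerivAt.finsetProd fun i _ => (hM (σ i) i).hasFDerivAt).differentiableAt

/-- Solutions of a regular linear system depend differentiably on the data. -/
lemma diff_solve {F ι : Type*} [NormedAddCommGroup F] [NormedSpace ℝ F] [Fintype ι]
    [DecidableEq ι] {M : F → Matrix ι ι ℝ} {u v : F → ι → ℝ} {x0 : F}
    (hM : ∀ p q, DifferentiableAt ℝ (fun x => M x p q) x0)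
    (hv : ∀ p, DifferentiableAt ℝ (fun x => v x p) x0) (hdet : (M x0).det ≠ 0)
    (h : ∀ᶠ x in 𝓝 x0, M x *ᵥ u x = v x) (p : ι) :
    DifferentiableAt ℝ (fun x => u x p) x0 := by
  have hd := diff_det hM
  have hne : ∀ᶠ x in 𝓝 x0, (M x).det ≠ 0 := hd.continuousAt.eventually_ne hdet
  have h1 : DifferentiableAt ℝ (fun x => ((M x).det)⁻¹ * ((M x).updateCol p (v x)).det) x0 := by
    refine (hd.fun_inv hdet).fun_mul (diff_det fun a q => ?_)
    simp only [Matrix.updateCol_apply]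
    split_ifs
    · exact hv a
    · exact hM a q
  refine h1.congr_of_eventuallyEq ?_
  filter_upwards [h, hne] with x hx hx0
  rw [← Matrix.cramer_apply, Matrix.cramer_eq_adjugate_mulVec, ← hx, Matrix.mulVec_mulVec,
    Matrix.adjugate_mul, Matrix.smul_mulVec, Matrix.one_mulVec, Pi.smul_apply, smul_eq_mul,
    inv_mul_cancel_left₀ hx0]

lemma PK_nonneg {d k N : ℕ} {Pr : Matrix (Fin N) (Fin N) ℝ} (hPr : ∀ i j, 0 ≤ Pr i j)
    {A : Fin N → Matrix (Fin d) (Fin d) ℝ} {B : Fin N → Matrix (Fin d) (Fin k) ℝ}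
    {Q : Fin N → Matrix (Fin d) (Fin d) ℝ} {R : Fin N → Matrix (Fin k) (Fin k) ℝ}
    (hQ : ∀ i, (Q i).PosDef) (hR : ∀ i, (R i).PosDef)
    {K : Fin N → Matrix (Fin k) (Fin d) ℝ} (h : Stab Pr (Gam A B K)) (i : Fin N) (x : Fin d → ℝ) :
    0 ≤ bf (PK Pr A B Q R K i) x x := by
  refine stab_nonneg hPr h (fun i x => ?_) i x
  conv_rhs => rw [PK_spec Q R h i]
  rw [bf_add, bf_add, bf_conj]
  linarith [posSemidef_bf (hQ i).posSemidef x, posSemidef_bf (hR i).posSemidef (K i *ᵥ x)]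

/-- uniform openness of stability -/
lemma stab_near {d k N : ℕ} (hd : 0 < d) (hN : 0 < N) {Pr : Matrix (Fin N) (Fin N) ℝ}
    (hPr : ∀ i j, 0 ≤ Pr i j) (hPrSum : ∀ i, ∑ j, Pr i j = 1)
    (A : Fin N → Matrix (Fin d) (Fin d) ℝ) (B : Fin N → Matrix (Fin d) (Fin k) ℝ)
    {Q : Fin N → Matrix (Fin d) (Fin d) ℝ} {R : Fin N → Matrix (Fin k) (Fin k) ℝ}
    (hQ : ∀ i, (Q i).PosDef) (hR : ∀ i, (R i).PosDef)
    {piv : Fin N → ℝ} (hpiv : ∀ i, 0 < piv i)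
    {Sg : Matrix (Fin d) (Fin d) ℝ} (hSg : Sg.PosDef) (α : ℝ) :
    ∃ δ > 0, ∀ K K' : Fin N → Matrix (Fin k) (Fin d) ℝ, Stab Pr (Gam A B K) →
      cost Pr A B Q R piv Sg K ≤ α →
      (∀ i, ((K' i - K i)ᵀ * (K' i - K i)).trace ≤ δ) → Stab Pr (Gam A B K') := by
  have hmu := mu_pos hd hN hpiv hSg
  have hΛ := lamMin_pos hd hN hQ
  set ε := lamMin Q with hε
  set c := |α| / mu piv Sg with hc
  have hc0 : 0 ≤ c := by positivity
  set κ := min 1 (ε / (6 * c + 1)) with hκ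
  have hκ0 : 0 < κ := lt_min one_pos (by positivity)
  have hκ1 : κ ≤ 1 := min_le_left _ _
  have hκ3 : κ * (6 * c + 1) ≤ ε := by
    have := min_le_right 1 (ε / (6 * c + 1))
    rwa [le_div_iff₀ (by positivity)] at this
  have hκ2 : c * (2 * κ + κ ^ 2) ≤ ε / 2 := by
    have : κ ^ 2 ≤ κ := by nlinarith
    nlinarith [mul_le_mul_of_nonneg_left this hc0]
  set b := maxNorm B with hb
  refine ⟨κ ^ 2 / (b ^ 2 + 1), by positivity, fun K K' hS hcost hKK => ?_⟩
  have hP0 := fun i x => PK_nonneg hPr (Q := Q) (R := R) hQ hR hS i x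
  refine stab_perturb hPr hPrSum hP0 hc0 (fun i x => ?_) hΛ (Γ := Gam A B K) (fun i x => ?_)
    hκ0 hκ2 (fun i x => ?_)
  · refine (bf_le_cost hpiv hSg hmu hP0 hcost i x).trans ?_
    refine mul_le_mul_of_nonneg_right ?_ (sq_nonneg' x)
    exact div_le_div_of_nonneg_right (le_abs_self α) hmu.le
  · conv_rhs => rw [PK_spec Q R hS i]
    rw [bf_add, bf_add, bf_conj]
    linarith [lamMin_bf hQ i x, posSemidef_bf (hR i).posSemidef (K i *ᵥ x)]
  · have e1 : (Gam A B K' i - Gam A B K i) *ᵥ x = B i *ᵥ (-((K' i - K i) *ᵥ x)) := by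
      have : Gam A B K' i - Gam A B K i = -(B i * (K' i - K i)) := by
        simp only [Gam, Matrix.mul_sub]; abel
      rw [this, Matrix.neg_mulVec, Matrix.mulVec_neg, Matrix.mulVec_mulVec]
    rw [e1]
    have h1 := sq_le_maxNorm B i (-((K' i - K i) *ᵥ x))
    have h2 : sq (-((K' i - K i) *ᵥ x)) = sq ((K' i - K i) *ᵥ x) := by simp [sq]
    rw [h2] at h1
    have h3 := sq_mulVec_le (K' i - K i) x
    have h4 := hKK i
    have h5 := mul_le_mul_of_nonneg_right h4 (sq_nonneg' x)
    have h6 := mul_le_mul_of_nonneg_left (h3.trans h5) (sq_nonneg b)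
    refine (h1.trans h6).trans ?_
    rw [← mul_assoc]
    refine mul_le_mul_of_nonneg_right ?_ (sq_nonneg' x)
    rw [mul_div_assoc', div_le_iff₀ (by positivity)]
    nlinarith [sq_nonneg κ, sq_nonneg b]

lemma stab_eventually {d k N : ℕ} (hd : 0 < d) (hN : 0 < N) {Pr : Matrix (Fin N) (Fin N) ℝ}
    (hPr : ∀ i j, 0 ≤ Pr i j) (hPrSum : ∀ i, ∑ j, Pr i j = 1)
    (A : Fin N → Matrix (Fin d) (Fin d) ℝ) (B : Fin N → Matrix (Fin d) (Fin k) ℝ)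
    {F : Type*} [TopologicalSpace F] {κ : F → Fin N → Matrix (Fin k) (Fin d) ℝ} {x0 : F}
    (hκ : ∀ i a b, ContinuousAt (fun x => κ x i a b) x0)
    (h : Stab Pr (Gam A B (κ x0))) : ∀ᶠ x in 𝓝 x0, Stab Pr (Gam A B (κ x)) := by
  obtain ⟨δ, hδ, hK⟩ := stab_near (k := k) hd hN hPr hPrSum A B (Q := fun _ => 1) (R := fun _ => 1)
    (fun _ => Matrix.PosDef.one) (fun _ => Matrix.PosDef.one) (piv := fun _ => 1)
    (fun _ => one_pos) (Sg := 1) Matrix.PosDef.one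
    (cost Pr A B (fun _ => 1) (fun _ => 1) (fun _ => 1) 1 (κ x0))
  have h1 : ∀ i, ∀ᶠ x in 𝓝 x0, ((κ x i - κ x0 i)ᵀ * (κ x i - κ x0 i)).trace ≤ δ := by
    intro i
    have hc : ContinuousAt (fun x => ((κ x i - κ x0 i)ᵀ * (κ x i - κ x0 i)).trace) x0 := by
      simp only [Matrix.trace, Matrix.diag, Matrix.mul_apply, Matrix.transpose_apply,
        Matrix.sub_apply]
      refine tendsto_finsetSum _ fun a _ => tendsto_finsetSum _ fun b _ => ?_
      exact (((hκ i b a).sub continuousAt_const).mul ((hκ i b a).sub continuousAt_const))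
    have : ((κ x0 i - κ x0 i)ᵀ * (κ x0 i - κ x0 i)).trace < δ := by simpa using hδ
    exact (hc.eventually_lt continuousAt_const this).mono fun x hx => le_of_lt hx
  filter_upwards [Filter.eventually_all.2 h1] with x hx
  exact hK _ _ h le_rfl hx

lemma diff_mul {F : Type*} [NormedAddCommGroup F] [NormedSpace ℝ F] {l m n : ℕ}
    {M : F → Matrix (Fin l) (Fin m) ℝ} {M' : F → Matrix (Fin m) (Fin n) ℝ} {x0 : F}
    (h : ∀ a b, DifferentiableAt ℝ (fun x => M x a b) x0)
    (h' : ∀ a b, DifferentiableAt ℝ (fun x => M' x a b) x0) (a : Fin l) (b : Fin n) :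
    DifferentiableAt ℝ (fun x => (M x * M' x) a b) x0 := by
  simp only [Matrix.mul_apply]
  exact DifferentiableAt.fun_sum fun c _ => (h a c).fun_mul (h' c b)

lemma diff_Gam {d k N : ℕ} (A : Fin N → Matrix (Fin d) (Fin d) ℝ)
    (B : Fin N → Matrix (Fin d) (Fin k) ℝ)
    {F : Type*} [NormedAddCommGroup F] [NormedSpace ℝ F]
    {κ : F → Fin N → Matrix (Fin k) (Fin d) ℝ} {x0 : F}
    (hκ : ∀ i a b, DifferentiableAt ℝ (fun x => κ x i a b) x0) (i : Fin N) (a b : Fin d) :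
    DifferentiableAt ℝ (fun x => Gam A B (κ x) i a b) x0 := by
  simp only [Gam, Matrix.sub_apply]
  exact (differentiableAt_const _).fun_sub
    (diff_mul (M := fun _ => B i) (fun a b => differentiableAt_const _) (hκ i) a b)

lemma diff_lyap {d N : ℕ} {Pr : Matrix (Fin N) (Fin N) ℝ}
    {F : Type*} [NormedAddCommGroup F] [NormedSpace ℝ F]
    {Γ U S : F → Fin N → Matrix (Fin d) (Fin d) ℝ} {x0 : F}
    (hΓ : ∀ i a b, DifferentiableAt ℝ (fun x => Γ x i a b) x0)
    (hS : ∀ i a b, DifferentiableAt ℝ (fun x => S x i a b) x0)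
    (hst : Stab Pr (Γ x0))
    (h : ∀ᶠ x in 𝓝 x0, ∀ i, U x i = S x i + opL Pr (Γ x) (U x) i) (i : Fin N) (a b : Fin d) :
    DifferentiableAt ℝ (fun x => U x i a b) x0 := by
  refine diff_solve (M := fun x => 1 - calA Pr (Γ x)) (u := fun x => vecT (U x))
    (v := fun x => vecT (S x)) (fun p q => ?_) (fun p => hS _ _ _) (stab_det hst) ?_ (i, a, b)
  · simp only [Matrix.sub_apply, calA_apply]
    exact (differentiableAt_const _).fun_sub
      (((hΓ _ _ _).fun_mul (hΓ _ _ _)).fun_mul (differentiableAt_const _))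
  · filter_upwards [h] with x hx
    exact (solves_iff _ _ _ _).2 hx

lemma diff_PK {d k N : ℕ} (hd : 0 < d) (hN : 0 < N) {Pr : Matrix (Fin N) (Fin N) ℝ}
    (hPr : ∀ i j, 0 ≤ Pr i j) (hPrSum : ∀ i, ∑ j, Pr i j = 1)
    (A : Fin N → Matrix (Fin d) (Fin d) ℝ) (B : Fin N → Matrix (Fin d) (Fin k) ℝ)
    (Q : Fin N → Matrix (Fin d) (Fin d) ℝ) (R : Fin N → Matrix (Fin k) (Fin k) ℝ)
    {F : Type*} [NormedAddCommGroup F] [NormedSpace ℝ F]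
    {κ : F → Fin N → Matrix (Fin k) (Fin d) ℝ} {x0 : F}
    (hκ : ∀ i a b, DifferentiableAt ℝ (fun x => κ x i a b) x0)
    (h : Stab Pr (Gam A B (κ x0))) (i : Fin N) (a b : Fin d) :
    DifferentiableAt ℝ (fun x => PK Pr A B Q R (κ x) i a b) x0 := by
  refine diff_lyap (Pr := Pr) (Γ := fun x => Gam A B (κ x))
    (S := fun x i => Q i + (κ x i)ᵀ * R i * κ x i)
    (U := fun x => PK Pr A B Q R (κ x))
    (diff_Gam A B hκ) (fun i a b => ?_) h ?_ i a b
  · simp only [Matrix.add_apply]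
    exact (differentiableAt_const _).fun_add
      (diff_mul (diff_mul (M := fun x => (κ x i)ᵀ) (M' := fun _ => R i) (fun a b => hκ i b a)
        (fun a b => differentiableAt_const _)) (hκ i) a b)
  · filter_upwards [stab_eventually hd hN hPr hPrSum A B (fun i a b => (hκ i a b).continuousAt) h]
      with x hx
    exact PK_spec Q R hx

lemma diff_cost {d k N : ℕ} (hd : 0 < d) (hN : 0 < N) {Pr : Matrix (Fin N) (Fin N) ℝ}
    (hPr : ∀ i j, 0 ≤ Pr i j) (hPrSum : ∀ i, ∑ j, Pr i j = 1)
    (A : Fin N → Matrix (Fin d) (Fin d) ℝ) (B : Fin N → Matrix (Fin d) (Fin k) ℝ)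
    (Q : Fin N → Matrix (Fin d) (Fin d) ℝ) (R : Fin N → Matrix (Fin k) (Fin k) ℝ)
    (piv : Fin N → ℝ) (Sg : Matrix (Fin d) (Fin d) ℝ)
    {F : Type*} [NormedAddCommGroup F] [NormedSpace ℝ F]
    {κ : F → Fin N → Matrix (Fin k) (Fin d) ℝ} {x0 : F}
    (hκ : ∀ i a b, DifferentiableAt ℝ (fun x => κ x i a b) x0)
    (h : Stab Pr (Gam A B (κ x0))) :
    DifferentiableAt ℝ (fun x => cost Pr A B Q R piv Sg (κ x)) x0 := by
  simp only [cost, Matrix.trace, Matrix.diag]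
  refine DifferentiableAt.fun_sum fun i _ => (differentiableAt_const _).fun_mul ?_
  refine DifferentiableAt.fun_sum fun a _ => ?_
  exact diff_mul (M' := fun _ => Sg) (diff_PK hd hN hPr hPrSum A B Q R hκ h i)
    (fun a b => differentiableAt_const _) a a

/-- entrywise derivative of a matrix valued path -/
def HD {m n : ℕ} (M : ℝ → Matrix (Fin m) (Fin n) ℝ) (M' : Matrix (Fin m) (Fin n) ℝ) (t : ℝ) :
    Prop := ∀ a b, HasDerivAt (fun s => M s a b) (M' a b) t

lemma HD.const {m n : ℕ} (M : Matrix (Fin m) (Fin n) ℝ) (t : ℝ) : HD (fun _ => M) 0 t :=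
  fun _ _ => hasDerivAt_const _ _

lemma HD.add {m n : ℕ} {M N : ℝ → Matrix (Fin m) (Fin n) ℝ} {M' N' : Matrix (Fin m) (Fin n) ℝ}
    {t : ℝ} (h : HD M M' t) (h' : HD N N' t) : HD (fun s => M s + N s) (M' + N') t :=
  fun a b => (h a b).add (h' a b)

lemma HD.sub {m n : ℕ} {M N : ℝ → Matrix (Fin m) (Fin n) ℝ} {M' N' : Matrix (Fin m) (Fin n) ℝ}
    {t : ℝ} (h : HD M M' t) (h' : HD N N' t) : HD (fun s => M s - N s) (M' - N') t :=
  fun a b => (h a b).sub (h' a b)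

lemma HD.transpose {m n : ℕ} {M : ℝ → Matrix (Fin m) (Fin n) ℝ} {M' : Matrix (Fin m) (Fin n) ℝ}
    {t : ℝ} (h : HD M M' t) : HD (fun s => (M s)ᵀ) M'ᵀ t :=
  fun a b => h b a

lemma HD.mul {l m n : ℕ} {M : ℝ → Matrix (Fin l) (Fin m) ℝ} {N : ℝ → Matrix (Fin m) (Fin n) ℝ}
    {M' : Matrix (Fin l) (Fin m) ℝ} {N' : Matrix (Fin m) (Fin n) ℝ} {t : ℝ}
    (h : HD M M' t) (h' : HD N N' t) : HD (fun s => M s * N s) (M' * N t + M t * N') t := by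
  intro a b
  simp only [Matrix.mul_apply, Matrix.add_apply, ← Finset.sum_add_distrib]
  exact HasDerivAt.fun_sum fun c _ => (h a c).mul (h' c b)

lemma HD.opE {d N : ℕ} (Pr : Matrix (Fin N) (Fin N) ℝ)
    {V : ℝ → Fin N → Matrix (Fin d) (Fin d) ℝ} {V' : Fin N → Matrix (Fin d) (Fin d) ℝ} {t : ℝ}
    (h : ∀ i, HD (fun s => V s i) (V' i) t) (i : Fin N) :
    HD (fun s => MJLS.opE Pr (V s) i) (MJLS.opE Pr V' i) t := by
  intro a b
  simp only [MJLS.opE, Matrix.sum_apply, Matrix.smul_apply, smul_eq_mul]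
  exact HasDerivAt.fun_sum fun c _ => (h c a b).const_mul _

lemma HD.unique {m n : ℕ} {M N : ℝ → Matrix (Fin m) (Fin n) ℝ} {M' N' : Matrix (Fin m) (Fin n) ℝ}
    {t : ℝ} (h : HD M M' t) (h' : HD N N' t) (e : ∀ᶠ s in 𝓝 t, M s = N s) : M' = N' := by
  ext a b
  refine (h a b).unique ((h' a b).congr_of_eventuallyEq ?_)
  filter_upwards [e] with s hs
  rw [hs]

lemma HD.trace {n : ℕ} {M : ℝ → Matrix (Fin n) (Fin n) ℝ} {M' : Matrix (Fin n) (Fin n) ℝ}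
    {t : ℝ} (h : HD M M' t) : HasDerivAt (fun s => (M s).trace) M'.trace t := by
  simp only [Matrix.trace, Matrix.diag]
  exact HasDerivAt.fun_sum fun c _ => h c c

/-- The entrywise derivative of a path of tuples. -/
noncomputable def dT {d N : ℕ} (V : ℝ → Fin N → Matrix (Fin d) (Fin d) ℝ) (t : ℝ) :
    Fin N → Matrix (Fin d) (Fin d) ℝ :=
  fun i => Matrix.of fun a b => deriv (fun s => V s i a b) t

lemma dT_HD {d N : ℕ} {V : ℝ → Fin N → Matrix (Fin d) (Fin d) ℝ} {t : ℝ}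
    (h : ∀ i a b, DifferentiableAt ℝ (fun s => V s i a b) t) (i : Fin N) :
    HD (fun s => V s i) (dT V t i) t :=
  fun a b => (h i a b).hasDerivAt

section path
variable {d k N : ℕ}
    (A : Fin N → Matrix (Fin d) (Fin d) ℝ) (B : Fin N → Matrix (Fin d) (Fin k) ℝ)
    (Q : Fin N → Matrix (Fin d) (Fin d) ℝ) (R : Fin N → Matrix (Fin k) (Fin k) ℝ)
    (K E : Fin N → Matrix (Fin k) (Fin d) ℝ)

/-- the straight path -/
def path {k d N : ℕ} (K E : Fin N → Matrix (Fin k) (Fin d) ℝ) (t : ℝ) :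
    Fin N → Matrix (Fin k) (Fin d) ℝ := fun i => K i + t • E i

lemma path_HD {k d N : ℕ} (K E : Fin N → Matrix (Fin k) (Fin d) ℝ) (t : ℝ) (i : Fin N) :
    HD (fun s => path K E s i) (E i) t := by
  intro a b
  simp only [path, Matrix.add_apply, Matrix.smul_apply, smul_eq_mul]
  simpa using ((hasDerivAt_id t).mul_const (E i a b)).const_add (K i a b)

lemma Gam_HD (t : ℝ) (i : Fin N) :
    HD (fun s => Gam A B (path K E s) i) (-(B i * E i)) t := by
  have := (HD.const (A i) t).sub ((HD.const (B i) t).mul (path_HD K E t i))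
  simpa [Gam] using this

lemma path_diff {k d N : ℕ} (K E : Fin N → Matrix (Fin k) (Fin d) ℝ) (t : ℝ) (i : Fin N)
    (a : Fin k) (b : Fin d) : DifferentiableAt ℝ (fun s => path K E s i a b) t :=
  (path_HD K E t i a b).differentiableAt

/-- The cost-to-go along the path. -/
noncomputable def PP (Pr : Matrix (Fin N) (Fin N) ℝ) (s : ℝ) : Fin N → Matrix (Fin d) (Fin d) ℝ :=
  PK Pr A B Q R (path K E s)

/-- The source term of the first derivative. -/
noncomputable def src1 (Pr : Matrix (Fin N) (Fin N) ℝ) (s : ℝ) :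
    Fin N → Matrix (Fin d) (Fin d) ℝ := fun i =>
  ((E i)ᵀ * R i * path K E s i + (path K E s i)ᵀ * R i * E i)
    - ((B i * E i)ᵀ * opE Pr (PP A B Q R K E Pr s) i * Gam A B (path K E s) i
      + (Gam A B (path K E s) i)ᵀ * opE Pr (PP A B Q R K E Pr s) i * (B i * E i))

end path

lemma path_open {d k N : ℕ} (hd : 0 < d) (hN : 0 < N) {Pr : Matrix (Fin N) (Fin N) ℝ}
    (hPr : ∀ i j, 0 ≤ Pr i j) (hPrSum : ∀ i, ∑ j, Pr i j = 1)
    (A : Fin N → Matrix (Fin d) (Fin d) ℝ) (B : Fin N → Matrix (Fin d) (Fin k) ℝ)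
    (K E : Fin N → Matrix (Fin k) (Fin d) ℝ)
    {t : ℝ} (h : Stab Pr (Gam A B (path K E t))) :
    ∀ᶠ s in 𝓝 t, Stab Pr (Gam A B (path K E s)) :=
  stab_eventually hd hN hPr hPrSum A B (fun i a b => (path_diff K E t i a b).continuousAt) h

lemma PP_HD {d k N : ℕ} (hd : 0 < d) (hN : 0 < N) {Pr : Matrix (Fin N) (Fin N) ℝ}
    (hPr : ∀ i j, 0 ≤ Pr i j) (hPrSum : ∀ i, ∑ j, Pr i j = 1)
    (A : Fin N → Matrix (Fin d) (Fin d) ℝ) (B : Fin N → Matrix (Fin d) (Fin k) ℝ)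
    (Q : Fin N → Matrix (Fin d) (Fin d) ℝ) (R : Fin N → Matrix (Fin k) (Fin k) ℝ)
    (K E : Fin N → Matrix (Fin k) (Fin d) ℝ)
    {t : ℝ} (h : Stab Pr (Gam A B (path K E t))) (i : Fin N) :
    HD (fun s => PP A B Q R K E Pr s i) (dT (PP A B Q R K E Pr) t i) t :=
  dT_HD (diff_PK hd hN hPr hPrSum A B Q R (path_diff K E t) h) i

lemma PP_eq1 {d k N : ℕ} (hd : 0 < d) (hN : 0 < N) {Pr : Matrix (Fin N) (Fin N) ℝ}
    (hPr : ∀ i j, 0 ≤ Pr i j) (hPrSum : ∀ i, ∑ j, Pr i j = 1)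
    (A : Fin N → Matrix (Fin d) (Fin d) ℝ) (B : Fin N → Matrix (Fin d) (Fin k) ℝ)
    (Q : Fin N → Matrix (Fin d) (Fin d) ℝ) (R : Fin N → Matrix (Fin k) (Fin k) ℝ)
    (K E : Fin N → Matrix (Fin k) (Fin d) ℝ)
    {t : ℝ} (h : Stab Pr (Gam A B (path K E t))) (i : Fin N) :
    dT (PP A B Q R K E Pr) t i = src1 A B Q R K E Pr t i
      + opL Pr (Gam A B (path K E t)) (dT (PP A B Q R K E Pr) t) i := by
  have hP := PP_HD hd hN hPr hPrSum A B Q R K E h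
  have hK := path_HD K E t i
  have hG := Gam_HD A B K E t i
  have h1 := ((HD.const (Q i) t).add ((hK.transpose.mul (HD.const (R i) t)).mul hK)).add
    ((hG.transpose.mul (HD.opE Pr hP i)).mul hG)
  refine ((hP i).unique h1 ?_).trans ?_
  · filter_upwards [path_open hd hN hPr hPrSum A B K E h] with s hs
    exact PK_spec Q R hs i
  · simp only [src1, opL, Matrix.mul_zero, add_zero, zero_add, Matrix.transpose_neg,
      Matrix.neg_mul, Matrix.mul_neg, Matrix.add_mul]
    abel

lemma src1_HD {d k N : ℕ} (hd : 0 < d) (hN : 0 < N) {Pr : Matrix (Fin N) (Fin N) ℝ}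
    (hPr : ∀ i j, 0 ≤ Pr i j) (hPrSum : ∀ i, ∑ j, Pr i j = 1)
    (A : Fin N → Matrix (Fin d) (Fin d) ℝ) (B : Fin N → Matrix (Fin d) (Fin k) ℝ)
    (Q : Fin N → Matrix (Fin d) (Fin d) ℝ) (R : Fin N → Matrix (Fin k) (Fin k) ℝ)
    (K E : Fin N → Matrix (Fin k) (Fin d) ℝ)
    {t : ℝ} (h : Stab Pr (Gam A B (path K E t))) (i : Fin N) :
    HD (fun s => src1 A B Q R K E Pr s i)
      ((2 : ℝ) • ((E i)ᵀ * R i * E i) + (2 : ℝ) • ((B i * E i)ᵀ * opE Pr (PP A B Q R K E Pr t) i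
        * (B i * E i)) - ((B i * E i)ᵀ * opE Pr (dT (PP A B Q R K E Pr) t) i *
          Gam A B (path K E t) i + (Gam A B (path K E t) i)ᵀ *
          opE Pr (dT (PP A B Q R K E Pr) t) i * (B i * E i))) t := by
  have hP := PP_HD hd hN hPr hPrSum A B Q R K E h
  have hK := path_HD K E t i
  have hG := Gam_HD A B K E t i
  have hO := HD.opE Pr hP i
  have h1 := (((HD.const ((E i)ᵀ * R i) t).mul hK).add
      ((hK.transpose.mul (HD.const (R i) t)).mul (HD.const (E i) t))).sub
    ((((HD.const (B i * E i)ᵀ t).mul hO).mul hG).add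
      ((hG.transpose.mul hO).mul (HD.const (B i * E i) t)))
  convert! h1 using 1
  simp only [Matrix.mul_zero, Matrix.zero_mul, add_zero, zero_add, Matrix.transpose_neg,
      Matrix.neg_mul, Matrix.mul_neg, Matrix.add_mul, two_smul]
  abel

lemma PP1_HD {d k N : ℕ} (hd : 0 < d) (hN : 0 < N) {Pr : Matrix (Fin N) (Fin N) ℝ}
    (hPr : ∀ i j, 0 ≤ Pr i j) (hPrSum : ∀ i, ∑ j, Pr i j = 1)
    (A : Fin N → Matrix (Fin d) (Fin d) ℝ) (B : Fin N → Matrix (Fin d) (Fin k) ℝ)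
    (Q : Fin N → Matrix (Fin d) (Fin d) ℝ) (R : Fin N → Matrix (Fin k) (Fin k) ℝ)
    (K E : Fin N → Matrix (Fin k) (Fin d) ℝ)
    {t : ℝ} (h : Stab Pr (Gam A B (path K E t))) (i : Fin N) :
    HD (fun s => dT (PP A B Q R K E Pr) s i) (dT (dT (PP A B Q R K E Pr)) t i) t := by
  refine dT_HD (diff_lyap (Pr := Pr) (Γ := fun s => Gam A B (path K E s))
    (S := src1 A B Q R K E Pr) (diff_Gam A B (path_diff K E t)) (fun i a b => ?_) h ?_) i
  · exact (src1_HD hd hN hPr hPrSum A B Q R K E h i a b).differentiableAt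
  · filter_upwards [path_open hd hN hPr hPrSum A B K E h] with s hs
    exact PP_eq1 hd hN hPr hPrSum A B Q R K E hs

lemma PP_eq2 {d k N : ℕ} (hd : 0 < d) (hN : 0 < N) {Pr : Matrix (Fin N) (Fin N) ℝ}
    (hPr : ∀ i j, 0 ≤ Pr i j) (hPrSum : ∀ i, ∑ j, Pr i j = 1)
    (A : Fin N → Matrix (Fin d) (Fin d) ℝ) (B : Fin N → Matrix (Fin d) (Fin k) ℝ)
    (Q : Fin N → Matrix (Fin d) (Fin d) ℝ) (R : Fin N → Matrix (Fin k) (Fin k) ℝ)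
    (K E : Fin N → Matrix (Fin k) (Fin d) ℝ)
    {t : ℝ} (h : Stab Pr (Gam A B (path K E t))) (i : Fin N) :
    dT (dT (PP A B Q R K E Pr)) t i =
      ((2 : ℝ) • ((E i)ᵀ * R i * E i) + (2 : ℝ) • ((B i * E i)ᵀ * opE Pr (PP A B Q R K E Pr t) i
        * (B i * E i)) - (2 : ℝ) • ((B i * E i)ᵀ * opE Pr (dT (PP A B Q R K E Pr) t) i *
          Gam A B (path K E t) i + (Gam A B (path K E t) i)ᵀ *
          opE Pr (dT (PP A B Q R K E Pr) t) i * (B i * E i)))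
      + opL Pr (Gam A B (path K E t)) (dT (dT (PP A B Q R K E Pr)) t) i := by
  have hP := PP1_HD hd hN hPr hPrSum A B Q R K E h
  have hG := Gam_HD A B K E t i
  have h1 := (src1_HD hd hN hPr hPrSum A B Q R K E h i).add
    ((hG.transpose.mul (HD.opE Pr hP i)).mul hG)
  refine ((hP i).unique h1 ?_).trans ?_
  · filter_upwards [path_open hd hN hPr hPrSum A B K E h] with s hs
    exact PP_eq1 hd hN hPr hPrSum A B Q R K E hs i
  · simp only [opL, Matrix.transpose_neg,
      Matrix.neg_mul, Matrix.mul_neg, Matrix.add_mul, two_smul]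
    abel


/-- one dimensional descent along a path, by continuous induction -/
lemma descent {φ φ1 φ2 : ℝ → ℝ} {S : Set ℝ} {α g L η : ℝ} (hS : ∀ t ∈ S, S ∈ 𝓝 t)
    (h1 : ∀ t ∈ S, HasDerivAt φ (φ1 t) t) (h2 : ∀ t ∈ S, HasDerivAt φ1 (φ2 t) t)
    (hb : ∀ t ∈ S, φ t ≤ α → φ2 t ≤ L * g) (hcl : IsClosed {t | t ∈ S ∧ φ t ≤ α})
    (h0 : 0 ∈ S) (h0α : φ 0 ≤ α) (hd0 : φ1 0 = -g) (hg : 0 < g) (hL : 0 < L)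
    (hη0 : 0 < η) (hη : η ≤ 1 / L) : η ∈ S ∧ φ η ≤ φ 0 - η / 2 * g := by
  set Z := {t | t ∈ S ∧ φ t ≤ α} with hZ
  have key1 : ∀ x, 0 ≤ x → Set.Icc 0 x ⊆ Z → φ1 x ≤ -g + L * g * x := by
    intro x hx hxZ
    have hd : ∀ t ∈ Set.Icc 0 x, HasDerivAt (fun t => φ1 t - L * g * t) (φ2 t - L * g) t := by
      intro t ht
      have := (h2 t (hxZ ht).1).fun_sub ((hasDerivAt_id t).const_mul (L * g))
      simpa using this
    have hanti : AntitoneOn (fun t => φ1 t - L * g * t) (Set.Icc 0 x) := by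
      refine antitoneOn_of_hasDerivWithinAt_nonpos (f' := fun t => φ2 t - L * g) (convex_Icc 0 x)
        (fun t ht => (hd t ht).continuousAt.continuousWithinAt)
        (fun t ht => (hd t (interior_subset ht)).hasDerivWithinAt) (fun t ht => ?_)
      have := hxZ (interior_subset ht)
      linarith [hb t this.1 this.2]
    have := hanti (Set.left_mem_Icc.2 hx) (Set.right_mem_Icc.2 hx) hx
    simp only [mul_zero, sub_zero, hd0] at this
    linarith
  have key2 : ∀ x, 0 ≤ x → Set.Icc 0 x ⊆ Z → φ x ≤ φ 0 - g * x + L * g * x ^ 2 / 2 := by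
    intro x hx hxZ
    have hd : ∀ t ∈ Set.Icc 0 x, HasDerivAt (fun t => φ t + g * t - L * g / 2 * t ^ 2)
        (φ1 t + g - L * g / 2 * (2 * t)) t := by
      intro t ht
      have := ((h1 t (hxZ ht).1).fun_add ((hasDerivAt_id t).const_mul g)).fun_sub
        ((hasDerivAt_pow 2 t).const_mul (L * g / 2))
      simpa using this
    have hanti : AntitoneOn (fun t => φ t + g * t - L * g / 2 * t ^ 2) (Set.Icc 0 x) := by
      refine antitoneOn_of_hasDerivWithinAt_nonpos
        (f' := fun t => φ1 t + g - L * g / 2 * (2 * t)) (convex_Icc 0 x)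
        (fun t ht => (hd t ht).continuousAt.continuousWithinAt)
        (fun t ht => (hd t (interior_subset ht)).hasDerivWithinAt) (fun t ht => ?_)
      have ht' := interior_subset ht
      have := key1 t ht'.1 ((Set.Icc_subset_Icc_right ht'.2).trans hxZ)
      linarith
    have := hanti (Set.left_mem_Icc.2 hx) (Set.right_mem_Icc.2 hx) hx
    simp only [mul_zero, add_zero] at this
    norm_num at this
    linarith
  have hsub : Set.Icc 0 η ⊆ {t | Set.Icc 0 t ⊆ Z} := by
    refine IsClosed.Icc_subset_of_forall_mem_nhdsWithin ?_ ?_ ?_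
    · refine IsClosed.inter ?_ isClosed_Icc
      refine isClosed_of_closure_subset fun t ht u hu => ?_
      rcases hu.2.lt_or_eq with hut | hut
      · obtain ⟨v, hv, hvs⟩ := mem_closure_iff_nhds.1 ht _ (Ioi_mem_nhds hut)
        exact hvs ⟨hu.1, le_of_lt hv⟩
      · subst hut
        rcases hu.1.eq_or_lt with h | h
        · rw [← h]; exact ⟨h0, h0α⟩
        · refine hcl.closure_subset (mem_closure_iff_nhds.2 fun U hU => ?_)
          obtain ⟨v, ⟨hv, hv0⟩, hvs⟩ :=
            mem_closure_iff_nhds.1 ht _ (Filter.inter_mem hU (Ioi_mem_nhds h))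
          exact ⟨v, hv, hvs ⟨le_of_lt hv0, le_rfl⟩⟩
    · intro u hu
      rw [Set.Icc_self, Set.mem_singleton_iff] at hu
      rw [hu]; exact ⟨h0, h0α⟩
    · rintro x ⟨hxs, hx0, hxη⟩
      have hxZ : x ∈ Z := hxs ⟨hx0, le_rfl⟩
      have hlt : φ1 x < 0 := by
        have hx1 := key1 x hx0 hxs
        have hLx : L * x < 1 := by
          have h3 := hxη.trans_le hη
          rwa [lt_div_iff₀ hL, mul_comm] at h3
        nlinarith
      have hsl := HasDerivWithinAt.limsup_slope_le' (s := Set.Ioi x)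
        (h1 x hxZ.1).hasDerivWithinAt (by simp) hlt
      have hev : ∀ᶠ z in 𝓝[>] x, z ∈ Z := by
        filter_upwards [hsl, self_mem_nhdsWithin, nhdsWithin_le_nhds (hS x hxZ.1)] with z hz hzx hzS
        refine ⟨hzS, le_trans ?_ hxZ.2⟩
        rw [slope_def_field, div_lt_iff₀ (sub_pos.2 hzx), zero_mul] at hz
        linarith
      obtain ⟨u, hu, hsu⟩ := (mem_nhdsGT_iff_exists_Ioo_subset).1 hev
      filter_upwards [Ioo_mem_nhdsGT hu] with z hz w hw
      rcases le_or_gt w x with hwx | hwx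
      · exact hxs ⟨hw.1, hwx⟩
      · exact hsu ⟨hwx, hw.2.trans_lt hz.2⟩
  have hηZ := hsub (Set.right_mem_Icc.2 hη0.le)
  refine ⟨(hηZ ⟨hη0.le, le_rfl⟩).1, (key2 η hη0.le hηZ).trans ?_⟩
  have hLη : η * L ≤ 1 := by rwa [le_div_iff₀ hL] at hη
  have : g * η * (η * L) ≤ g * η * 1 := mul_le_mul_of_nonneg_left hLη (by positivity)
  nlinarith

section pathcost
variable {d N : ℕ} (piv : Fin N → ℝ) (Sg : Matrix (Fin d) (Fin d) ℝ)

/-- the linear functional defining the cost -/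
def lc {d N : ℕ} (piv : Fin N → ℝ) (Sg : Matrix (Fin d) (Fin d) ℝ)
    (V : Fin N → Matrix (Fin d) (Fin d) ℝ) : ℝ := ∑ i, piv i * (V i * Sg).trace

lemma lc_HD {V : ℝ → Fin N → Matrix (Fin d) (Fin d) ℝ} {V' : Fin N → Matrix (Fin d) (Fin d) ℝ}
    {t : ℝ} (h : ∀ i, HD (fun s => V s i) (V' i) t) :
    HasDerivAt (fun s => lc piv Sg (V s)) (lc piv Sg V') t := by
  unfold lc
  refine HasDerivAt.fun_sum fun i _ => HasDerivAt.const_mul _ ?_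
  have := ((h i).mul (HD.const Sg t)).trace
  simpa using this

lemma norm2sq_trace_le {a b : ℕ} (V : Fin N → Matrix (Fin a) (Fin b) ℝ) (i : Fin N) :
    ((V i)ᵀ * V i).trace ≤ norm2sq V := by
  refine Finset.single_le_sum (f := fun i => ((V i)ᵀ * V i).trace) (fun j _ => ?_)
    (Finset.mem_univ i)
  refine Finset.sum_nonneg fun c _ => ?_
  simp only [Matrix.diag, Matrix.mul_apply, Matrix.transpose_apply]
  exact Finset.sum_nonneg fun c _ => mul_self_nonneg _

end pathcost

lemma phi2_bound {d k N : ℕ} (hd : 0 < d) (hN : 0 < N) {Pr : Matrix (Fin N) (Fin N) ℝ}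
    (hPr : ∀ i j, 0 ≤ Pr i j) (hPrSum : ∀ i, ∑ j, Pr i j = 1)
    (A : Fin N → Matrix (Fin d) (Fin d) ℝ) (B : Fin N → Matrix (Fin d) (Fin k) ℝ)
    (Q : Fin N → Matrix (Fin d) (Fin d) ℝ) (R : Fin N → Matrix (Fin k) (Fin k) ℝ)
    (piv : Fin N → ℝ) (Sg : Matrix (Fin d) (Fin d) ℝ)
    (K E : Fin N → Matrix (Fin k) (Fin d) ℝ)
    (hpiv : ∀ i, 0 < piv i) (hSg : Sg.PosDef) (hQ : ∀ i, (Q i).PosDef)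
    (hR : ∀ i, (R i).PosDef) {α : ℝ} (hα : 0 < α) (hE : 0 < norm2sq E) {t : ℝ}
    (h : Stab Pr (Gam A B (path K E t))) (ht : cost Pr A B Q R piv Sg (path K E t) ≤ α) :
    lc piv Sg (dT (dT (PP A B Q R K E Pr)) t) ≤ Lsm B R Q piv Sg α * norm2sq E := by
  have hmu := mu_pos hd hN hpiv hSg
  have hΛ := lamMin_pos hd hN hQ
  have hP0 := fun i x => PK_nonneg hPr (Q := Q) (R := R) hQ hR h i x
  have hPa := bf_le_cost hpiv hSg hmu hP0 ht
  have hr0 := maxNorm_nonneg R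
  have hb0 := maxNorm_nonneg B
  have eP : ∀ i x, bf (PK Pr A B Q R (path K E t) i) x x = bf (Q i) x x
      + bf (R i) (path K E t i *ᵥ x) (path K E t i *ᵥ x)
      + bf (opL Pr (Gam A B (path K E t)) (PK Pr A B Q R (path K E t)) i) x x := by
    intro i x
    conv_lhs => rw [PK_spec Q R h i]
    rw [bf_add, bf_add, bf_conj]
  have haΛ : lamMin Q ≤ α / mu piv Sg := by
    let i0 : Fin N := ⟨0, hN⟩
    let a0 : Fin d := ⟨0, hd⟩
    have h1 := hPa i0 (Pi.single a0 1)
    have h2 := eP i0 (Pi.single a0 1)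
    have h3 := lamMin_bf hQ i0 (Pi.single a0 1)
    have h4 := posSemidef_bf (hR i0).posSemidef (path K E t i0 *ᵥ (Pi.single a0 1))
    have h5 : 0 ≤ bf (opL Pr (Gam A B (path K E t)) (PK Pr A B Q R (path K E t)) i0)
        (Pi.single a0 1) (Pi.single a0 1) := by
      rw [bf_opL]
      exact Finset.sum_nonneg fun j _ => mul_nonneg (hPr _ j) (hP0 j _)
    have h6 : sq (Pi.single a0 1 : Fin d → ℝ) = 1 := by simp [sq]
    rw [h6] at h1 h3
    linarith
  set a := α / mu piv Sg with ha
  set b := maxNorm B with hb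
  set r := maxNorm R with hr
  set Λ := lamMin Q with hΛd
  set g := norm2sq E with hg
  set ξ := (1 / Λ) * ((1 + b ^ 2) * a + r) - 1 with hξ
  have ha0 : 0 ≤ a := by positivity
  have hξ0 : 0 ≤ ξ := by
    have h1 : 1 ≤ (1 / Λ) * ((1 + b ^ 2) * a + r) := by
      rw [one_div, ← div_eq_inv_mul, le_div_iff₀ hΛ]
      nlinarith [mul_nonneg (sq_nonneg b) ha0]
    linarith
  have hes : (Real.sqrt g) ^ 2 = g := Real.sq_sqrt hE.le
  have hb2 := hess_bound hPr hPrSum h (P := PK Pr A B Q R (path K E t)) (K := path K E t) (E := E)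
    (Q := Q) (R := R) (B := B)
    (P1 := dT (PP A B Q R K E Pr) t) (P2 := dT (dT (PP A B Q R K E Pr)) t) (e := Real.sqrt g)
    hr0 hb0 hΛ (Real.sqrt_pos.2 hE) haΛ (fun i => posSemidef_bf (hR i).posSemidef)
    (bf_le_maxNorm R) (sq_le_maxNorm B) (fun i x => by
      rw [hes]
      exact (sq_mulVec_le (E i) x).trans
        (mul_le_mul_of_nonneg_right (norm2sq_trace_le E i) (sq_nonneg' x)))
    (lamMin_bf hQ) hP0 hPa hξ eP (fun i x => by
      conv_lhs => rw [PP_eq1 hd hN hPr hPrSum A B Q R K E h i]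
      simp only [src1, PP, bf_add, bf_sub, bf_conj, Matrix.mulVec_mulVec]) (fun i x => by
      conv_lhs => rw [PP_eq2 hd hN hPr hPrSum A B Q R K E h i]
      simp only [PP, bf_add, bf_sub, bf_smul, bf_conj, Matrix.mulVec_mulVec])
  rw [hes] at hb2
  set C := 2 * (r + b ^ 2 * a + 2 * b * ξ * a) * g / Λ with hC
  have hC0 : 0 ≤ C := by positivity
  have hlc : lc piv Sg (dT (dT (PP A B Q R K E Pr)) t) ≤
      C * cost Pr A B Q R piv Sg (path K E t) := by
    unfold lc cost
    rw [Finset.mul_sum]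
    refine Finset.sum_le_sum fun i _ => ?_
    have h1 := trace_mono' (P := dT (dT (PP A B Q R K E Pr)) t i)
      (P' := C • PK Pr A B Q R (path K E t) i) (M := Sg)
      (fun x => by rw [bf_smul]; exact hb2 i x) hSg.posSemidef
    rw [Matrix.smul_mul, Matrix.trace_smul, smul_eq_mul] at h1
    calc _ ≤ _ := mul_le_mul_of_nonneg_left h1 (hpiv i).le
      _ = _ := by ring
  refine hlc.trans ((mul_le_mul_of_nonneg_left ht hC0).trans (le_of_eq ?_))
  have hxi : xi B R Q piv Sg α = ξ := by
    simp only [xi, hξ, ha, mul_div_assoc]; rfl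
  unfold Lsm
  rw [hxi, hC, ← hb, ← hr, ← hΛd]
  by_cases hb00 : b = 0
  · rw [hb00]; ring
  · have : b ^ 2 * (1 + 2 * ξ / b) * α / mu piv Sg = b ^ 2 * a + 2 * b * ξ * a := by
      rw [ha]; field_simp
    rw [this]; ring

lemma path_closed {d k N : ℕ} (hd : 0 < d) (hN : 0 < N) {Pr : Matrix (Fin N) (Fin N) ℝ}
    (hPr : ∀ i j, 0 ≤ Pr i j) (hPrSum : ∀ i, ∑ j, Pr i j = 1)
    (A : Fin N → Matrix (Fin d) (Fin d) ℝ) (B : Fin N → Matrix (Fin d) (Fin k) ℝ)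
    (Q : Fin N → Matrix (Fin d) (Fin d) ℝ) (R : Fin N → Matrix (Fin k) (Fin k) ℝ)
    (piv : Fin N → ℝ) (Sg : Matrix (Fin d) (Fin d) ℝ)
    (K E : Fin N → Matrix (Fin k) (Fin d) ℝ)
    (hpiv : ∀ i, 0 < piv i) (hSg : Sg.PosDef) (hQ : ∀ i, (Q i).PosDef)
    (hR : ∀ i, (R i).PosDef) (α : ℝ) :
    IsClosed {t | t ∈ {t | Stab Pr (Gam A B (path K E t))} ∧
      cost Pr A B Q R piv Sg (path K E t) ≤ α} := by
  obtain ⟨δ, hδ, hδs⟩ := stab_near (k := k) hd hN hPr hPrSum A B hQ hR hpiv hSg α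
  refine isClosed_of_closure_subset fun t ht => ?_
  rw [mem_closure_iff_frequently] at ht
  have hst : Stab Pr (Gam A B (path K E t)) := by
    have hev : ∀ᶠ s in 𝓝 t, (t - s) ^ 2 * norm2sq E ≤ δ := by
      have hc : ContinuousAt (fun s : ℝ => (t - s) ^ 2 * norm2sq E) t := by fun_prop
      exact (hc.eventually_lt continuousAt_const (by simpa using hδ)).mono fun x hx => le_of_lt hx
    obtain ⟨s, hs, hsδ⟩ := (ht.and_eventually hev).exists
    refine hδs _ _ hs.1 hs.2 fun i => le_trans ?_ hsδ
    have e1 : path K E t i - path K E s i = (t - s) • E i := by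
      simp only [path, sub_smul]; abel
    rw [e1, Matrix.transpose_smul, Matrix.smul_mul, Matrix.mul_smul, smul_smul,
      Matrix.trace_smul, smul_eq_mul, pow_two]
    exact mul_le_mul_of_nonneg_left (norm2sq_trace_le E i) (mul_self_nonneg _)
  refine ⟨hst, ?_⟩
  by_contra hcon
  rw [not_le] at hcon
  have hc := (diff_cost hd hN hPr hPrSum A B Q R piv Sg (path_diff K E t) hst).continuousAt
  have hev := (continuousAt_const (y := α)).eventually_lt hc hcon
  obtain ⟨s, hs, hs'⟩ := (ht.and_eventually hev).exists
  exact absurd hs.2 (not_le.2 hs')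


attribute [local instance] Matrix.normedAddCommGroup Matrix.normedSpace

/-- one-step feasibility and descent of gradient descent. -/
theorem gd_one_step_feasibility_descent
    (d k N : ℕ) (hd : 0 < d) (hk : 0 < k) (hN : 0 < N)
    (A : Fin N → Matrix (Fin d) (Fin d) ℝ) (B : Fin N → Matrix (Fin d) (Fin k) ℝ)
    (Pr : Matrix (Fin N) (Fin N) ℝ)
    (hPr : ∀ i j, 0 ≤ Pr i j) (hPrSum : ∀ i, ∑ j, Pr i j = 1)
    (piv : Fin N → ℝ) (hpiv : ∀ i, 0 < piv i) (hpivSum : ∑ i, piv i = 1)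
    (Sg : Matrix (Fin d) (Fin d) ℝ) (hSg : Sg.PosDef)
    (Q : Fin N → Matrix (Fin d) (Fin d) ℝ) (hQ : ∀ i, (Q i).PosDef)
    (R : Fin N → Matrix (Fin k) (Fin k) ℝ) (hR : ∀ i, (R i).PosDef)
    (α : ℝ) (hα : 0 < α)
    (K : Fin N → Matrix (Fin k) (Fin d) ℝ) (hK : MSS Pr A B K) (hKα : cost Pr A B Q R piv Sg K ≤ α)
    (G : Fin N → Matrix (Fin k) (Fin d) ℝ)
    (hG : ∀ E : Fin N → Matrix (Fin k) (Fin d) ℝ, fderiv ℝ (cost Pr A B Q R piv Sg) K E = ip G E)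
    (η : ℝ) (hη0 : 0 < η) (hη : η ≤ 1 / Lsm B R Q piv Sg α) :
    (MSS Pr A B (K - η • G) ∧ cost Pr A B Q R piv Sg (K - η • G) ≤ α) ∧
    cost Pr A B Q R piv Sg (K - η • G) ≤ cost Pr A B Q R piv Sg K - η / 2 * norm2sq G := by
  have hS := (mss_iff_stab Pr A B K).1 hK
  have hnn : 0 ≤ norm2sq G := by
    let i0 : Fin N := ⟨0, hN⟩
    refine le_trans ?_ (norm2sq_trace_le G i0)
    refine Finset.sum_nonneg fun c _ => ?_
    simp only [Matrix.diag, Matrix.mul_apply, Matrix.transpose_apply]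
    exact Finset.sum_nonneg fun c _ => mul_self_nonneg _
  rcases hnn.eq_or_lt with hg | hg
  · have hG0 : G = 0 := by
      funext i
      have h1 : ((G i)ᵀ * G i).trace ≤ 0 := (norm2sq_trace_le G i).trans_eq hg.symm
      ext a b
      have h2 := sq_mulVec_le (G i) (Pi.single b 1)
      have h3 : sq (G i *ᵥ Pi.single b 1) = 0 := by
        refine le_antisymm (h2.trans ?_) (sq_nonneg' _)
        exact mul_nonpos_of_nonpos_of_nonneg h1 (sq_nonneg' _)
      have h4 : G i *ᵥ Pi.single b 1 = 0 := dotProduct_self_eq_zero.1 h3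
      have h5 := congrFun h4 a
      simpa using h5
    rw [← hg, hG0]
    simp only [smul_zero, sub_zero, mul_zero]
    exact ⟨⟨hK, hKα⟩, le_rfl⟩
  · have hL : 0 < Lsm B R Q piv Sg α := by
      by_contra hcon
      rw [not_lt] at hcon
      have := div_nonpos_of_nonneg_of_nonpos (zero_le_one (α := ℝ)) hcon
      linarith
    have hneg : norm2sq (-G) = norm2sq G := by simp [norm2sq]
    have hp0 : path K (-G) 0 = K := by funext i; simp [path]
    have hpη : path K (-G) η = K - η • G := by
      funext i; simp [path, sub_eq_add_neg]
    have hd1 : ∀ t, Stab Pr (Gam A B (path K (-G) t)) →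
        HasDerivAt (fun s => cost Pr A B Q R piv Sg (path K (-G) s))
          (lc piv Sg (dT (PP A B Q R K (-G) Pr) t)) t := fun t ht =>
      lc_HD piv Sg (PP_HD hd hN hPr hPrSum A B Q R K (-G) ht)
    have hS0 : Stab Pr (Gam A B (path K (-G) 0)) := by rw [hp0]; exact hS
    have hder : lc piv Sg (dT (PP A B Q R K (-G) Pr) 0) = - norm2sq G := by
      have hdiff : DifferentiableAt ℝ (cost Pr A B Q R piv Sg) K := by
        refine diff_cost hd hN hPr hPrSum A B Q R piv Sg (κ := fun x => x) (fun i a b => ?_) hS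
        fun_prop
      have h1 := hdiff.hasFDerivAt.hasLineDerivAt (-G)
      have h2 := (hd1 0 hS0).unique h1
      refine h2.trans ((hG (-G)).trans ?_)
      simp [ip, norm2sq]
    have hfin := descent (S := {t | Stab Pr (Gam A B (path K (-G) t))})
      (φ := fun s => cost Pr A B Q R piv Sg (path K (-G) s)) (α := α) (g := norm2sq G)
      (L := Lsm B R Q piv Sg α) (η := η)
      (fun t ht => path_open hd hN hPr hPrSum A B K (-G) ht) hd1
      (fun t ht => lc_HD piv Sg (PP1_HD hd hN hPr hPrSum A B Q R K (-G) ht))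
      (fun t ht hta => by
        have := phi2_bound hd hN hPr hPrSum A B Q R piv Sg K (-G) hpiv hSg hQ hR hα
          (by rw [hneg]; exact hg) ht hta
        rwa [hneg] at this)
      (path_closed hd hN hPr hPrSum A B Q R piv Sg K (-G) hpiv hSg hQ hR α) hS0
      (by rw [hp0]; exact hKα) hder hg hL hη0 hη
    simp only [hp0, hpη, Set.mem_ofPred_eq] at hfin
    refine ⟨⟨(mss_iff_stab _ _ _ _).2 hfin.1, ?_⟩, hfin.2⟩
    have : 0 ≤ η / 2 * norm2sq G := by positivity
    linarith [hfin.2]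

end MJLS
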